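/- arXiv:2203.08988 — 2 statements merged into one kernel-verified Lean document; each statement's English description precedes it below -/
import Mathlib

section
/- Let C₀, M > 0. There exists a constant C₁ > 0, depending only on L, T, C₀, M (and in particular not on ε), such that for every ε ∈ (0,1), all smooth data with C₀⁻¹(1−y) ≤ u₀^ε(x,y) ≤ C₀(1−y), C₀⁻¹(1−y) ≤ u₁^ε(y,t) ≤ C₀(1−y), v₀^ε ≤ 0, |v₀^ε| ≤ M, and with the C²-norms of U, P bounded by M and U ≥ M⁻¹, every classical solution u of the regularized problem (2.9) satisfies C₁⁻¹(1−y) ≤ u(x,y,t) ≤ C₁(1−y) for all (x,y,t) ∈ Q_T. -/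
open Real Set MeasureTheory

noncomputable section

/-- Partial derivative in the first variable of a two-variable function. -/
def pd1 (f : ℝ → ℝ → ℝ) (x t : ℝ) : ℝ := deriv (fun x' => f x' t) x

/-- Partial derivative in the second variable of a two-variable function. -/
def pd2 (f : ℝ → ℝ → ℝ) (x t : ℝ) : ℝ := deriv (fun t' => f x t') t

/-- Partial derivatives of a function of `(x, y, t)`. -/
def Dx (u : ℝ → ℝ → ℝ → ℝ) (x y t : ℝ) : ℝ := deriv (fun s => u s y t) x
def Dy (u : ℝ → ℝ → ℝ → ℝ) (x y t : ℝ) : ℝ := deriv (fun s => u x s t) y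
def Dt (u : ℝ → ℝ → ℝ → ℝ) (x y t : ℝ) : ℝ := deriv (fun s => u x y s) t
def Dyy (u : ℝ → ℝ → ℝ → ℝ) (x y t : ℝ) : ℝ := iteratedDeriv 2 (fun s => u x s t) y

/-- The coefficient `b = (1-y²)∂ₓU + (1-y)∂ₜU/U`. -/
def bcoef (U : ℝ → ℝ → ℝ) (x y t : ℝ) : ℝ :=
  (1 - y ^ 2) * pd1 U x t + (1 - y) * pd2 U x t / U x t

/-- The coefficient `c = (1-y)∂ₓU - ∂ₓP/U`. -/
def ccoef (U P : ℝ → ℝ → ℝ) (x y t : ℝ) : ℝ :=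
  (1 - y) * pd1 U x t - pd1 P x t / U x t

def Smooth2 (f : ℝ → ℝ → ℝ) : Prop := ContDiff ℝ (⊤ : ℕ∞) (fun p : ℝ × ℝ => f p.1 p.2)
def Smooth3 (u : ℝ → ℝ → ℝ → ℝ) : Prop :=
  ContDiff ℝ (⊤ : ℕ∞) (fun p : ℝ × ℝ × ℝ => u p.1 p.2.1 p.2.2)

/-- `C²`-norm of `f` bounded by `M` on `s₁ × s₂`. -/
def C2Bound (f : ℝ → ℝ → ℝ) (s₁ s₂ : Set ℝ) (M : ℝ) : Prop :=
  ∀ x ∈ s₁, ∀ t ∈ s₂,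
    |f x t| ≤ M ∧ |pd1 f x t| ≤ M ∧ |pd2 f x t| ≤ M ∧
    |pd1 (pd1 f) x t| ≤ M ∧ |pd2 (pd2 f) x t| ≤ M ∧ |pd2 (pd1 f) x t| ≤ M

/-- Background Euler flow data: smooth `U > 0`, `P`, Bernoulli law, favorable pressure,
`C²`-norms bounded by `M` and `U ≥ M⁻¹`. -/
def EulerData (L T M : ℝ) (U P : ℝ → ℝ → ℝ) : Prop :=
  Smooth2 U ∧ Smooth2 P ∧
  (∀ x ∈ Icc 0 L, ∀ t ∈ Icc 0 T, 0 < U x t) ∧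
  (∀ x ∈ Icc 0 L, ∀ t ∈ Icc 0 T, pd2 U x t + U x t * pd1 U x t + pd1 P x t = 0) ∧
  (∀ x ∈ Icc 0 L, ∀ t ∈ Icc 0 T, pd1 P x t ≤ 0) ∧
  C2Bound U (Icc 0 L) (Icc 0 T) M ∧ C2Bound P (Icc 0 L) (Icc 0 T) M ∧
  (∀ x ∈ Icc 0 L, ∀ t ∈ Icc 0 T, M⁻¹ ≤ U x t)

/-- Classical solution of the regularized problem (2.9). -/
def RegSolution (L T ε : ℝ) (U P : ℝ → ℝ → ℝ)
    (u₀ u₁ v₀ : ℝ → ℝ → ℝ) (u : ℝ → ℝ → ℝ → ℝ) : Prop :=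
  Smooth3 u ∧
  (∀ x ∈ Ioo 0 L, ∀ y ∈ Ioo (0:ℝ) 1, ∀ t ∈ Ioo 0 T,
    Dt u x y t - (u x y t + ε) ^ 2 * Dyy u x y t + (y * U x t + ε) * Dx u x y t
      + bcoef U x y t * Dy u x y t + ccoef U P x y t * u x y t = 0) ∧
  (∀ x ∈ Icc 0 L, ∀ y ∈ Icc (0:ℝ) 1, u x y 0 = u₀ x y) ∧
  (∀ y ∈ Icc (0:ℝ) 1, ∀ t ∈ Icc 0 T, u 0 y t = u₁ y t) ∧
  (∀ x ∈ Icc 0 L, ∀ t ∈ Icc 0 T, u x 1 t = 0) ∧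
  (∀ x ∈ Icc 0 L, ∀ t ∈ Icc 0 T,
    (u x 0 t + ε) * Dy u x 0 t = v₀ x t * (u x 0 t + ε) + pd1 P x t / U x t)

/-- The data bounds: smooth nonnegative data with `C₀⁻¹(1-y) ≤ u₀, u₁ ≤ C₀(1-y)`, `v₀ ≤ 0`. -/
def DataBounds (L T C₀ : ℝ) (u₀ u₁ v₀ : ℝ → ℝ → ℝ) : Prop :=
  Smooth2 u₀ ∧ Smooth2 u₁ ∧ Smooth2 v₀ ∧
  (∀ x ∈ Icc 0 L, ∀ y ∈ Icc (0:ℝ) 1,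
    C₀⁻¹ * (1 - y) ≤ u₀ x y ∧ u₀ x y ≤ C₀ * (1 - y)) ∧
  (∀ y ∈ Icc (0:ℝ) 1, ∀ t ∈ Icc 0 T,
    C₀⁻¹ * (1 - y) ≤ u₁ y t ∧ u₁ y t ≤ C₀ * (1 - y)) ∧
  (∀ x ∈ Icc 0 L, ∀ t ∈ Icc 0 T, v₀ x t ≤ 0)

lemma Smooth3.contDiff_x {u : ℝ → ℝ → ℝ → ℝ} (hu : Smooth3 u) (y t : ℝ) :
    ContDiff ℝ 2 (fun s => u s y t) := by
  have h : ContDiff ℝ (⊤ : ℕ∞) (fun s : ℝ => u s y t) :=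
    ContDiff.comp (g := fun p : ℝ × ℝ × ℝ => u p.1 p.2.1 p.2.2) (f := fun s : ℝ => (s, y, t))
      hu (by fun_prop)
  exact contDiff_infty.1 h 2

lemma Smooth3.contDiff_y {u : ℝ → ℝ → ℝ → ℝ} (hu : Smooth3 u) (x t : ℝ) :
    ContDiff ℝ 2 (fun s => u x s t) := by
  have h : ContDiff ℝ (⊤ : ℕ∞) (fun s : ℝ => u x s t) :=
    ContDiff.comp (g := fun p : ℝ × ℝ × ℝ => u p.1 p.2.1 p.2.2) (f := fun s : ℝ => (x, s, t))
      hu (by fun_prop)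
  exact contDiff_infty.1 h 2

lemma Smooth3.contDiff_t {u : ℝ → ℝ → ℝ → ℝ} (hu : Smooth3 u) (x y : ℝ) :
    ContDiff ℝ 2 (fun s => u x y s) := by
  have h : ContDiff ℝ (⊤ : ℕ∞) (fun s : ℝ => u x y s) :=
    ContDiff.comp (g := fun p : ℝ × ℝ × ℝ => u p.1 p.2.1 p.2.2) (f := fun s : ℝ => (x, y, s))
      hu (by fun_prop)
  exact contDiff_infty.1 h 2

/-- At a minimum over an interval to its left, the derivative is nonpositive. -/
lemma deriv_nonpos_of_min_left {f : ℝ → ℝ} {f' l a : ℝ} (hf : HasDerivAt f f' a) (hl : l < a)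
    (hmin : ∀ s ∈ Ioo l a, f a ≤ f s) : f' ≤ 0 := by
  refine le_of_tendsto (hasDerivWithinAt_iff_tendsto_slope' (s := Iio a) (by simp) |>.1
    hf.hasDerivWithinAt) ?_
  filter_upwards [Ioo_mem_nhdsLT hl] with s hs
  rw [slope_def_field]
  exact div_nonpos_of_nonneg_of_nonpos (by linarith [hmin s hs]) (by linarith [hs.2])

/-- At a minimum over an interval to its right, the derivative is nonnegative. -/
lemma deriv_nonneg_of_min_right {f : ℝ → ℝ} {f' a r : ℝ} (hf : HasDerivAt f f' a) (hr : a < r)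
    (hmin : ∀ s ∈ Ioo a r, f a ≤ f s) : 0 ≤ f' := by
  refine ge_of_tendsto (hasDerivWithinAt_iff_tendsto_slope' (s := Ioi a) (by simp) |>.1
    hf.hasDerivWithinAt) ?_
  filter_upwards [Ioo_mem_nhdsGT hr] with s hs
  rw [slope_def_field]
  exact div_nonneg (by linarith [hmin s hs]) (by linarith [hs.1])

/-- Second-order necessary condition at a local minimum. -/
lemma deriv_deriv_nonneg_of_isLocalMin {f : ℝ → ℝ} {a : ℝ} (hf : ContinuousAt f a)
    (hmin : IsLocalMin f a) : 0 ≤ deriv (deriv f) a := by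
  by_contra! hneg
  have hmax : IsLocalMax f a := isLocalMax_of_deriv_deriv_neg hneg hmin.deriv_eq_zero hf
  have hconst : f =ᶠ[nhds a] fun _ => f a := by
    filter_upwards [hmin, hmax] with s h1 h2 using le_antisymm h2 h1
  have h := hconst.deriv.deriv_eq
  simp only [deriv_const'] at h
  linarith

/-- First contact of two smooth functions which are strictly ordered on the parabolic part
`{t = 0} ∪ {x = 0} ∪ {y = 1}` of the boundary of a box. -/
lemma exists_first_contact {v w : ℝ → ℝ → ℝ → ℝ} (hv : Smooth3 v) (hw : Smooth3 w) {X τ : ℝ}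
    (h0 : ∀ x ∈ Icc 0 X, ∀ y ∈ Icc (0:ℝ) 1, v x y 0 < w x y 0)
    (hx0 : ∀ y ∈ Icc (0:ℝ) 1, ∀ t ∈ Icc 0 τ, v 0 y t < w 0 y t)
    (hy1 : ∀ x ∈ Icc 0 X, ∀ t ∈ Icc 0 τ, v x 1 t < w x 1 t)
    (hne : ∃ x ∈ Icc 0 X, ∃ y ∈ Icc (0:ℝ) 1, ∃ t ∈ Icc 0 τ, w x y t ≤ v x y t) :
    ∃ x ∈ Ioc 0 X, ∃ y ∈ Ico (0:ℝ) 1, ∃ t ∈ Ioc 0 τ, v x y t = w x y t ∧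
      Dt w x y t ≤ Dt v x y t ∧ Dx w x y t ≤ Dx v x y t ∧
      (y = 0 → Dy v x y t ≤ Dy w x y t) ∧
      (0 < y → Dy v x y t = Dy w x y t ∧ Dyy v x y t ≤ Dyy w x y t) := by
  have hcv : Continuous (fun p : ℝ × ℝ × ℝ => v p.1 p.2.1 p.2.2) := ContDiff.continuous hv
  have hcw : Continuous (fun p : ℝ × ℝ × ℝ => w p.1 p.2.1 p.2.2) := ContDiff.continuous hw
  have hK : IsCompact ((Icc 0 X ×ˢ Icc (0:ℝ) 1 ×ˢ Icc 0 τ) ∩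
      {p : ℝ × ℝ × ℝ | w p.1 p.2.1 p.2.2 ≤ v p.1 p.2.1 p.2.2}) :=
    (isCompact_Icc.prod (isCompact_Icc.prod isCompact_Icc)).inter_right (isClosed_le hcw hcv)
  obtain ⟨x₁, hx₁, y₁, hy₁, t₁, ht₁, hle₁⟩ := hne
  obtain ⟨⟨x, y, t⟩, ⟨⟨hx, hy, ht⟩, hle⟩, hmin⟩ := hK.exists_isMinOn
    ⟨(x₁, y₁, t₁), ⟨hx₁, hy₁, ht₁⟩, hle₁⟩
    (f := fun p : ℝ × ℝ × ℝ => p.2.2) (by fun_prop)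
  simp only [mem_ofPred_eq] at hle hx hy ht
  have hxpos : 0 < x := by
    refine lt_of_le_of_ne hx.1 ?_
    rintro rfl
    exact absurd (hx0 y hy t ht) (not_lt.2 hle)
  have htpos : 0 < t := by
    refine lt_of_le_of_ne ht.1 ?_
    rintro rfl
    exact absurd (h0 x hx y hy) (not_lt.2 hle)
  have hylt : y < 1 := by
    refine lt_of_le_of_ne hy.2 ?_
    rintro rfl
    exact absurd (hy1 x hx t ht) (not_lt.2 hle)
  have hbefore : ∀ x' ∈ Icc 0 X, ∀ y' ∈ Icc (0:ℝ) 1, ∀ s ∈ Ioo 0 t, v x' y' s < w x' y' s := by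
    intro x' hx' y' hy' s hs
    by_contra! hcon
    have := hmin (a := (x', y', s)) ⟨⟨hx', hy', ⟨hs.1.le, hs.2.le.trans ht.2⟩⟩, hcon⟩
    simp only [mem_ofPred_eq] at this
    linarith [hs.2]
  have hat : ∀ x' ∈ Icc 0 X, ∀ y' ∈ Icc (0:ℝ) 1, 0 ≤ w x' y' t - v x' y' t := by
    intro x' hx' y' hy'
    have hcont : Continuous fun s => w x' y' s - v x' y' s :=
      (hw.contDiff_t x' y').continuous.sub (hv.contDiff_t x' y').continuous
    refine ge_of_tendsto (hcont.continuousAt.tendsto.mono_left (nhdsWithin_le_nhds (s := Iio t))) ?_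
    filter_upwards [Ioo_mem_nhdsLT htpos] with s hs
    linarith [hbefore x' hx' y' hy' s hs]
  have heq : v x y t = w x y t := le_antisymm (by linarith [hat x hx y hy]) hle
  have two : (2 : WithTop ℕ∞) ≠ 0 := by norm_num
  have dvx := ((hv.contDiff_x y t).differentiable two x).hasDerivAt
  have dwx := ((hw.contDiff_x y t).differentiable two x).hasDerivAt
  have dvy := ((hv.contDiff_y x t).differentiable two y).hasDerivAt
  have dwy := ((hw.contDiff_y x t).differentiable two y).hasDerivAt
  have dvt := ((hv.contDiff_t x y).differentiable two t).hasDerivAt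
  have dwt := ((hw.contDiff_t x y).differentiable two t).hasDerivAt
  refine ⟨x, ⟨hxpos, hx.2⟩, y, ⟨hy.1, hylt⟩, t, ⟨htpos, ht.2⟩, heq, ?_, ?_, ?_, ?_⟩
  · refine sub_nonpos.1 (deriv_nonpos_of_min_left (dwt.sub dvt) htpos fun s hs => ?_)
    have := hbefore x hx y hy s hs
    simp only [Pi.sub_apply]
    linarith
  · refine sub_nonpos.1 (deriv_nonpos_of_min_left (dwx.sub dvx) hxpos fun s hs => ?_)
    have := hat s ⟨hs.1.le, hs.2.le.trans hx.2⟩ y hy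
    simp only [Pi.sub_apply]
    linarith
  · rintro rfl
    refine sub_nonneg.1 (deriv_nonneg_of_min_right (dwy.sub dvy) zero_lt_one fun s hs => ?_)
    have := hat x hx s ⟨hs.1.le, hs.2.le⟩
    simp only [Pi.sub_apply]
    linarith
  · intro hypos
    have hloc : IsLocalMin ((fun s => w x s t) - fun s => v x s t) y := by
      filter_upwards [Ioo_mem_nhds hypos hylt] with s hs
      have := hat x hx s ⟨hs.1.le, hs.2.le⟩
      simp only [Pi.sub_apply]
      linarith
    refine ⟨?_, ?_⟩
    · have := hloc.hasDerivAt_eq_zero (dwy.sub dvy)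
      simp only [Dy]
      linarith
    · have h2 := deriv_deriv_nonneg_of_isLocalMin (dwy.sub dvy).continuousAt hloc
      have h3 := iteratedDeriv_sub (x := y) (n := 2) (hw.contDiff_y x t).contDiffAt
        (hv.contDiff_y x t).contDiffAt
      rw [iteratedDeriv_succ, iteratedDeriv_one] at h3
      simp only [Dyy]
      linarith

lemma abs_bcoef_le {U : ℝ → ℝ → ℝ} {M x y t : ℝ} (hy : y ∈ Icc (0:ℝ) 1)
    (h1 : |pd1 U x t| ≤ M) (h2 : |pd2 U x t / U x t| ≤ M ^ 2) :
    |bcoef U x y t| ≤ (2 * M + M ^ 2) * (1 - y) := by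
  obtain ⟨hy0, hy1⟩ := hy
  have h : bcoef U x y t = ((1 + y) * pd1 U x t + pd2 U x t / U x t) * (1 - y) := by
    unfold bcoef; ring
  rw [h, abs_mul, abs_of_nonneg (sub_nonneg.2 hy1)]
  refine mul_le_mul_of_nonneg_right ((abs_add_le _ _).trans (add_le_add ?_ h2)) (by linarith)
  rw [abs_mul, abs_of_nonneg (by linarith)]
  exact mul_le_mul (by linarith) h1 (abs_nonneg _) (by norm_num)

lemma abs_ccoef_le {U P : ℝ → ℝ → ℝ} {M x y t : ℝ} (hy : y ∈ Icc (0:ℝ) 1)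
    (h1 : |pd1 U x t| ≤ M) (h2 : |pd1 P x t / U x t| ≤ M ^ 2) :
    |ccoef U P x y t| ≤ M + M ^ 2 := by
  obtain ⟨hy0, hy1⟩ := hy
  refine (abs_sub _ _).trans (add_le_add ?_ h2)
  rw [abs_mul, abs_of_nonneg (sub_nonneg.2 hy1)]
  nlinarith [abs_nonneg (pd1 U x t)]

lemma abs_div_le_sq {a b M : ℝ} (hM : 0 < M) (ha : |a| ≤ M) (hb : M⁻¹ ≤ b) :
    |a / b| ≤ M ^ 2 := by
  have hb0 : 0 < b := (inv_pos.2 hM).trans_le hb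
  rw [abs_div, abs_of_pos hb0, div_le_iff₀ hb0]
  have : 1 ≤ M * b := by
    have := mul_le_mul_of_nonneg_left hb hM.le
    rwa [mul_inv_cancel₀ hM.ne'] at this
  nlinarith

/-- The supersolution `(Λ (1 - y) + δ) e^{Kt}`. -/
def upperBarrier (Λ K δ : ℝ) (_x y t : ℝ) : ℝ := (Λ * (1 - y) + δ) * exp (K * t)

/-- The subsolution `Λ ((1 - y) - (1 - y)³ / 2) e^{-Kt} - δ e^{Kt}`. -/
def lowerBarrier (Λ K δ : ℝ) (_x y t : ℝ) : ℝ :=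
  Λ * ((1 - y) - (1 - y) ^ 3 / 2) * exp (-(K * t)) - δ * exp (K * t)

section Barriers

variable (Λ K δ x y t : ℝ)

lemma smooth3_upperBarrier : Smooth3 (upperBarrier Λ K δ) := by
  unfold Smooth3 upperBarrier; fun_prop

lemma smooth3_lowerBarrier : Smooth3 (lowerBarrier Λ K δ) := by
  unfold Smooth3 lowerBarrier; fun_prop

lemma Dx_upperBarrier : Dx (upperBarrier Λ K δ) x y t = 0 := by
  simp [Dx, upperBarrier]

lemma Dx_lowerBarrier : Dx (lowerBarrier Λ K δ) x y t = 0 := by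
  simp [Dx, lowerBarrier]

lemma hasDerivAt_exp_mul (k s : ℝ) : HasDerivAt (fun s => exp (k * s)) (k * exp (k * s)) s := by
  simpa [mul_comm] using ((hasDerivAt_id s).const_mul k).exp

lemma Dt_upperBarrier : Dt (upperBarrier Λ K δ) x y t = K * upperBarrier Λ K δ x y t := by
  have h := ((hasDerivAt_exp_mul K t).const_mul (Λ * (1 - y) + δ)).deriv
  simp only [Dt, upperBarrier, h]
  ring

lemma Dt_lowerBarrier : Dt (lowerBarrier Λ K δ) x y t =
    -K * (Λ * ((1 - y) - (1 - y) ^ 3 / 2) * exp (-(K * t))) - K * (δ * exp (K * t)) := by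
  have h1 := (hasDerivAt_exp_mul (-K) t).const_mul (Λ * ((1 - y) - (1 - y) ^ 3 / 2))
  have h := (h1.sub ((hasDerivAt_exp_mul K t).const_mul δ)).deriv
  simp only [neg_mul] at h
  simp only [Dt, lowerBarrier]
  refine h.trans ?_
  ring

lemma Dy_upperBarrier : Dy (upperBarrier Λ K δ) x y t = -(Λ * exp (K * t)) := by
  have h := (((((hasDerivAt_id y).const_sub 1).const_mul Λ).add_const δ).mul_const
    (exp (K * t))).deriv
  simp only [Dy, upperBarrier]
  refine h.trans ?_
  ring

lemma hasDerivAt_lowerBarrier_y : HasDerivAt (fun s => lowerBarrier Λ K δ x s t)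
    (Λ * exp (-(K * t)) * (3 / 2 * (1 - y) ^ 2 - 1)) y := by
  have h1 := (hasDerivAt_id y).const_sub 1
  have h := (((h1.sub ((h1.pow 3).div_const 2)).const_mul Λ).mul_const
    (exp (-(K * t)))).sub_const (δ * exp (K * t))
  refine h.congr_deriv ?_
  simp
  ring

lemma Dy_lowerBarrier : Dy (lowerBarrier Λ K δ) x y t =
    Λ * exp (-(K * t)) * (3 / 2 * (1 - y) ^ 2 - 1) :=
  (hasDerivAt_lowerBarrier_y Λ K δ x y t).deriv

lemma Dyy_upperBarrier : Dyy (upperBarrier Λ K δ) x y t = 0 := by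
  have h : deriv (fun s => upperBarrier Λ K δ x s t) = fun _ => -(Λ * exp (K * t)) :=
    funext fun s => Dy_upperBarrier Λ K δ x s t
  rw [Dyy, iteratedDeriv_succ, iteratedDeriv_one, h, deriv_const]

lemma Dyy_lowerBarrier : Dyy (lowerBarrier Λ K δ) x y t =
    -(3 * (1 - y) * (Λ * exp (-(K * t)))) := by
  have h : deriv (fun s => lowerBarrier Λ K δ x s t) =
      fun s => Λ * exp (-(K * t)) * (3 / 2 * (1 - s) ^ 2 - 1) :=
    funext fun s => Dy_lowerBarrier Λ K δ x s t
  rw [Dyy, iteratedDeriv_succ, iteratedDeriv_one, h]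
  have h1 := (hasDerivAt_id y).const_sub 1
  refine ((((h1.pow 2).const_mul (3 / 2)).sub_const 1).const_mul
    (Λ * exp (-(K * t)))).deriv.trans ?_
  simp
  ring

end Barriers

section Comparison

variable {L T C₀ M ε : ℝ} {U P u₀ u₁ v₀ : ℝ → ℝ → ℝ} {u : ℝ → ℝ → ℝ → ℝ}

/-- The coefficient bounds which follow from the bounds on the Euler flow. -/
lemma EulerData.coef_bounds (hM : 0 < M) (hE : EulerData L T M U P) {x y t : ℝ}
    (hx : x ∈ Icc 0 L) (hy : y ∈ Icc (0:ℝ) 1) (ht : t ∈ Icc 0 T) :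
    |bcoef U x y t| ≤ (2 * M + M ^ 2) * (1 - y) ∧ |ccoef U P x y t| ≤ M + M ^ 2 ∧
      |pd1 P x t / U x t| ≤ M ^ 2 ∧ pd1 P x t / U x t ≤ 0 ∧ 0 < U x t := by
  obtain ⟨-, -, hpos, -, hfav, hU, hP, hlow⟩ := hE
  obtain ⟨-, hU1, hU2, -⟩ := hU x hx t ht
  obtain ⟨-, hP1, -⟩ := hP x hx t ht
  have hb := hlow x hx t ht
  have hPU := abs_div_le_sq hM hP1 hb
  exact ⟨abs_bcoef_le hy hU1 (abs_div_le_sq hM hU2 hb), abs_ccoef_le hy hU1 hPU, hPU,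
    div_nonpos_of_nonpos_of_nonneg (hfav x hx t ht) (hpos x hx t ht).le, hpos x hx t ht⟩

lemma lt_upperBarrier (hM : 0 < M) (hC₀ : 0 < C₀) (hε : 0 < ε)
    (hE : EulerData L T M U P) (hD : DataBounds L T C₀ u₀ u₁ v₀)
    (hv : ∀ x ∈ Icc 0 L, ∀ t ∈ Icc 0 T, |v₀ x t| ≤ M)
    (hR : RegSolution L T ε U P u₀ u₁ v₀ u) {x y t δ : ℝ}
    (hx : x ∈ Ioo 0 L) (hy : y ∈ Ioo (0:ℝ) 1) (ht : t ∈ Ioo 0 T) (hδ : 0 < δ) :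
    u x y t < upperBarrier (C₀ + M + M ^ 2 + 1) (3 * M + 2 * M ^ 2 + 1) δ x y t := by
  obtain ⟨hu, hpde, hu0, hux0, huy1, hbc⟩ := hR
  obtain ⟨-, -, -, hd0, hd1, -⟩ := hD
  set Λ := C₀ + M + M ^ 2 + 1 with hΛ
  set K := 3 * M + 2 * M ^ 2 + 1 with hK
  have hKpos : 0 < K := by positivity
  have hΛpos : 0 < Λ := by positivity
  have hCΛ : C₀ ≤ Λ := by nlinarith
  have hexp : ∀ s, 0 ≤ s → 1 ≤ exp (K * s) := fun s hs => one_le_exp (by positivity)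
  have hside : ∀ y' ∈ Icc (0:ℝ) 1, ∀ s, 0 ≤ s → ∀ x',
      C₀ * (1 - y') < upperBarrier Λ K δ x' y' s := by
    intro y' hy' s hs x'
    have h1 := hexp s hs
    have h2 : C₀ * (1 - y') ≤ Λ * (1 - y') :=
      mul_le_mul_of_nonneg_right hCΛ (by linarith [hy'.2])
    have h3 : 0 ≤ Λ * (1 - y') := mul_nonneg hΛpos.le (by linarith [hy'.2])
    unfold upperBarrier
    nlinarith
  by_contra! hcon
  obtain ⟨x', hx', y', hy', t', ht', heq, hDt, hDx, hDy0, hDyi⟩ :=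
    exists_first_contact hu (smooth3_upperBarrier Λ K δ) (X := x) (τ := t)
      (fun a ha b hb => by
        have haL : a ∈ Icc 0 L := ⟨ha.1, ha.2.trans hx.2.le⟩
        rw [hu0 a haL b hb]
        exact (hd0 a haL b hb).2.trans_lt (hside b hb 0 le_rfl a))
      (fun b hb s hs => by
        have hsT : s ∈ Icc 0 T := ⟨hs.1, hs.2.trans ht.2.le⟩
        rw [hux0 b hb s hsT]
        exact (hd1 b hb s hsT).2.trans_lt (hside b hb s hs.1 0))
      (fun a ha s hs => by
        rw [huy1 a ⟨ha.1, ha.2.trans hx.2.le⟩ s ⟨hs.1, hs.2.trans ht.2.le⟩]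
        simpa using hside 1 ⟨zero_le_one, le_rfl⟩ s hs.1 a)
      ⟨x, ⟨hx.1.le, le_rfl⟩, y, ⟨hy.1.le, hy.2.le⟩, t, ⟨ht.1.le, le_rfl⟩, hcon⟩
  have hxo : x' ∈ Ioo 0 L := ⟨hx'.1, hx'.2.trans_lt hx.2⟩
  have hto : t' ∈ Ioo 0 T := ⟨ht'.1, ht'.2.trans_lt ht.2⟩
  have hxc := Ioo_subset_Icc_self hxo
  have htc := Ioo_subset_Icc_self hto
  have hE1 := hexp t' ht'.1.le
  obtain ⟨hb, hc, hPU, -, hU⟩ := hE.coef_bounds hM hxc ⟨hy'.1, hy'.2.le⟩ htc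
  rw [Dt_upperBarrier] at hDt
  rw [Dx_upperBarrier] at hDx
  have hz : 0 < 1 - y' := by linarith [hy'.2]
  have hφ : 0 ≤ Λ * exp (K * t') * (1 - y') := by positivity
  have hsplit : upperBarrier Λ K δ x' y' t' =
      Λ * exp (K * t') * (1 - y') + δ * exp (K * t') := by
    unfold upperBarrier; ring
  have hδe : 0 < δ * exp (K * t') := by positivity
  rcases hy'.1.eq_or_lt with h0 | hpos
  · have hDy := hDy0 h0.symm
    rw [Dy_upperBarrier] at hDy
    subst h0
    have hB := hbc x' hxc t' htc
    have hv' := (abs_le.1 (hv x' hxc t' htc)).1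
    have hPU' := (abs_le.1 hPU).1
    have hΛe : Λ ≤ Λ * exp (K * t') := le_mul_of_one_le_right hΛpos.le hE1
    have hu1 : 1 ≤ u x' 0 t' + ε := by nlinarith
    have hDylt : Dy u x' 0 t' < -(M + M ^ 2) := by linarith
    nlinarith
  · obtain ⟨hDy, hDyy⟩ := hDyi hpos
    rw [Dy_upperBarrier] at hDy
    rw [Dyy_upperBarrier] at hDyy
    have hp := hpde x' hxo y' ⟨hpos, hy'.2⟩ t' hto
    have h1 : (u x' y' t' + ε) ^ 2 * Dyy u x' y' t' ≤ 0 :=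
      mul_nonpos_of_nonneg_of_nonpos (sq_nonneg _) hDyy
    have h2 : 0 ≤ (y' * U x' t' + ε) * Dx u x' y' t' := mul_nonneg (by positivity) hDx
    have h3 : bcoef U x' y' t' * Dy u x' y' t' ≥
        -((2 * M + M ^ 2) * (Λ * exp (K * t') * (1 - y'))) := by
      rw [hDy]
      have := mul_le_mul_of_nonneg_right (abs_le.1 hb).2 (by positivity : 0 ≤ Λ * exp (K * t'))
      linarith
    have h4 : ccoef U P x' y' t' * u x' y' t' ≥ -((M + M ^ 2) * u x' y' t') := by
      have := mul_le_mul_of_nonneg_right (abs_le.1 hc).1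
        (by rw [heq, hsplit]; positivity : 0 ≤ u x' y' t')
      linarith
    rw [← heq] at hDt hsplit
    have h5 : (2 * M + M ^ 2) * (Λ * exp (K * t') * (1 - y')) ≤ (2 * M + M ^ 2) * u x' y' t' :=
      mul_le_mul_of_nonneg_left (by linarith) (by positivity)
    have h6 : K * u x' y' t' = (2 * M + M ^ 2) * u x' y' t' + (M + M ^ 2) * u x' y' t' +
      u x' y' t' := by rw [hK]; ring
    linarith

set_option maxHeartbeats 800000 in
lemma lowerBarrier_lt (hM : 0 < M) (hC₀ : 0 < C₀) (hε : ε ∈ Ioo (0:ℝ) 1)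
    (hE : EulerData L T M U P) (hD : DataBounds L T C₀ u₀ u₁ v₀)
    (hR : RegSolution L T ε U P u₀ u₁ v₀ u) {K x y t δ : ℝ}
    (hK : K = 6 * (C₀⁻¹ + 1) ^ 2 + 5 * M + 3 * M ^ 2 + 1)
    (hx : x ∈ Ioo 0 L) (hy : y ∈ Ioo (0:ℝ) 1) (ht : t ∈ Ioo 0 T) (hδ : 0 < δ)
    (hδε : δ * exp (K * T) < ε) :
    lowerBarrier C₀⁻¹ K δ x y t < u x y t := by
  obtain ⟨hu, hpde, hu0, hux0, huy1, hbc⟩ := hR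
  obtain ⟨-, -, -, hd0, hd1, hv0⟩ := hD
  set Λ := C₀⁻¹ with hΛ
  have hΛpos : 0 < Λ := inv_pos.2 hC₀
  have hKpos : 0 < K := by rw [hK]; positivity
  have hexp : ∀ s, 0 ≤ s → exp (-(K * s)) ≤ 1 := fun s hs => exp_le_one_iff.2 (by
    have := mul_nonneg hKpos.le hs
    linarith)
  have hside : ∀ y' ∈ Icc (0:ℝ) 1, ∀ s, 0 ≤ s → ∀ x',
      lowerBarrier Λ K δ x' y' s < Λ * (1 - y') := by
    intro y' hy' s hs x'
    have h1 := hexp s hs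
    have hz : 0 ≤ 1 - y' := by linarith [hy'.2]
    have h3 : Λ * ((1 - y') - (1 - y') ^ 3 / 2) * exp (-(K * s)) ≤ Λ * (1 - y') * 1 := by
      refine mul_le_mul (mul_le_mul_of_nonneg_left ?_ hΛpos.le) h1 (exp_pos _).le (by positivity)
      have : 0 ≤ (1 - y') ^ 3 := by positivity
      linarith
    have h4 : 0 < δ * exp (K * s) := by positivity
    unfold lowerBarrier
    linarith
  by_contra! hcon
  obtain ⟨x', hx', y', hy', t', ht', heq, hDt, hDx, hDy0, hDyi⟩ :=
    exists_first_contact (smooth3_lowerBarrier Λ K δ) hu (X := x) (τ := t)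
      (fun a ha b hb => by
        have haL : a ∈ Icc 0 L := ⟨ha.1, ha.2.trans hx.2.le⟩
        rw [hu0 a haL b hb]
        exact (hside b hb 0 le_rfl a).trans_le (hd0 a haL b hb).1)
      (fun b hb s hs => by
        have hsT : s ∈ Icc 0 T := ⟨hs.1, hs.2.trans ht.2.le⟩
        rw [hux0 b hb s hsT]
        exact (hside b hb s hs.1 0).trans_le (hd1 b hb s hsT).1)
      (fun a ha s hs => by
        rw [huy1 a ⟨ha.1, ha.2.trans hx.2.le⟩ s ⟨hs.1, hs.2.trans ht.2.le⟩]
        simpa using hside 1 ⟨zero_le_one, le_rfl⟩ s hs.1 a)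
      ⟨x, ⟨hx.1.le, le_rfl⟩, y, ⟨hy.1.le, hy.2.le⟩, t, ⟨ht.1.le, le_rfl⟩, hcon⟩
  have hxo : x' ∈ Ioo 0 L := ⟨hx'.1, hx'.2.trans_lt hx.2⟩
  have hto : t' ∈ Ioo 0 T := ⟨ht'.1, ht'.2.trans_lt ht.2⟩
  have hxc := Ioo_subset_Icc_self hxo
  have htc := Ioo_subset_Icc_self hto
  obtain ⟨hb, hc, -, hPU, hU⟩ := hE.coef_bounds hM hxc ⟨hy'.1, hy'.2.le⟩ htc
  rw [Dt_lowerBarrier] at hDt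
  rw [Dx_lowerBarrier] at hDx
  have hz : 0 < 1 - y' := by linarith [hy'.2]
  have hz1 : 1 - y' ≤ 1 := by linarith [hy'.1]
  have hz2 : (1 - y') ^ 2 ≤ 1 := pow_le_one₀ hz.le hz1
  have hz3 : (1 - y') ^ 3 ≤ 1 - y' := by nlinarith
  have hE0 := exp_pos (-(K * t'))
  have hE1 := hexp t' ht'.1.le
  set A := Λ * exp (-(K * t')) with hA
  have hApos : 0 < A := by positivity
  have hAle : A ≤ Λ := mul_le_of_le_one_right hΛpos.le hE1
  set φ := Λ * ((1 - y') - (1 - y') ^ 3 / 2) * exp (-(K * t')) with hφ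
  have hφA : φ = A * ((1 - y') - (1 - y') ^ 3 / 2) := by rw [hφ, hA]; ring
  have hzφ : A * (1 - y') ≤ 2 * φ := by rw [hφA]; nlinarith
  have hφpos : 0 < φ := by nlinarith
  have hφle : φ ≤ Λ := by
    have : 0 ≤ (1 - y') ^ 3 := by positivity
    rw [hφA]
    nlinarith
  set η := δ * exp (K * t') with hη
  have hηpos : 0 < η := by positivity
  have hηε : η < ε := by
    refine lt_of_le_of_lt ?_ hδε
    have : exp (K * t') ≤ exp (K * T) :=
      exp_le_exp.2 (mul_le_mul_of_nonneg_left hto.2.le hKpos.le)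
    exact mul_le_mul_of_nonneg_left this hδ.le
  have hval : u x' y' t' = φ - η := heq.symm
  have huε : 0 < u x' y' t' + ε := by linarith
  rcases hy'.1.eq_or_lt with h0 | hpos
  · have hDy := hDy0 h0.symm
    rw [Dy_lowerBarrier] at hDy
    subst h0
    have hB := hbc x' hxc t' htc
    have hv' := hv0 x' hxc t' htc
    have hDypos : 0 < Dy u x' 0 t' := by
      have : A * (3 / 2 * (1 - 0) ^ 2 - 1) = A / 2 := by ring
      rw [this] at hDy
      linarith
    have := mul_pos huε hDypos
    nlinarith
  · obtain ⟨hDy, hDyy⟩ := hDyi hpos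
    rw [Dy_lowerBarrier] at hDy
    rw [Dyy_lowerBarrier] at hDyy
    have hp := hpde x' hxo y' ⟨hpos, hy'.2⟩ t' hto
    have h1 : (u x' y' t' + ε) ^ 2 * Dyy u x' y' t' ≥ -((Λ + 1) ^ 2 * (6 * φ)) := by
      have hsq : (u x' y' t' + ε) ^ 2 ≤ (Λ + 1) ^ 2 :=
        pow_le_pow_left₀ huε.le (by linarith [hε.2]) 2
      have ha := mul_le_mul_of_nonneg_left hDyy (sq_nonneg (u x' y' t' + ε))
      have hb := mul_le_mul hsq (by linarith : 3 * (1 - y') * A ≤ 6 * φ) (by positivity)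
        (by positivity)
      linarith
    have h2 : (y' * U x' t' + ε) * Dx u x' y' t' ≤ 0 :=
      mul_nonpos_of_nonneg_of_nonpos (by have := hε.1; positivity) hDx
    have h3 : bcoef U x' y' t' * Dy u x' y' t' ≤ (2 * M + M ^ 2) * (2 * φ) := by
      rw [← hDy]
      have hq : |A * (3 / 2 * (1 - y') ^ 2 - 1)| ≤ A := by
        rw [abs_mul, abs_of_pos hApos]
        refine mul_le_of_le_one_right hApos.le (abs_le.2 ⟨?_, ?_⟩) <;> nlinarith
      calc _ ≤ |bcoef U x' y' t' * (A * (3 / 2 * (1 - y') ^ 2 - 1))| := le_abs_self _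
        _ = |bcoef U x' y' t'| * |A * (3 / 2 * (1 - y') ^ 2 - 1)| := abs_mul _ _
        _ ≤ (2 * M + M ^ 2) * (1 - y') * A := mul_le_mul hb hq (abs_nonneg _) (by positivity)
        _ = (2 * M + M ^ 2) * (A * (1 - y')) := by ring
        _ ≤ _ := mul_le_mul_of_nonneg_left hzφ (by positivity)
    have h4 : ccoef U P x' y' t' * u x' y' t' ≤ (M + M ^ 2) * (φ + η) := by
      calc _ ≤ |ccoef U P x' y' t' * u x' y' t'| := le_abs_self _
        _ = |ccoef U P x' y' t'| * |u x' y' t'| := abs_mul _ _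
        _ ≤ _ := mul_le_mul hc (abs_le.2 ⟨by linarith, by linarith⟩) (abs_nonneg _)
          (by positivity)
    have h5 : K * φ = (Λ + 1) ^ 2 * (6 * φ) + (2 * M + M ^ 2) * (2 * φ) + (M + M ^ 2) * φ + φ := by
      rw [hK]; ring
    have h6 : (M + M ^ 2) * η ≤ K * η := by
      refine mul_le_mul_of_nonneg_right ?_ hηpos.le
      rw [hK]
      nlinarith [sq_nonneg (Λ + 1)]
    linarith

end Comparison

/-- Uniform pointwise bounds `C₁⁻¹(1-y) ≤ u ≤ C₁(1-y)` for the regularized solutions. -/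
theorem supnorm_bound_regularized (L T C₀ M : ℝ)
    (hL : 0 < L) (hT : 0 < T) (hC₀ : 0 < C₀) (hM : 0 < M) :
    ∃ C₁ > (0:ℝ), ∀ ε ∈ Ioo (0:ℝ) 1, ∀ U P : ℝ → ℝ → ℝ, ∀ u₀ u₁ v₀ : ℝ → ℝ → ℝ,
      ∀ u : ℝ → ℝ → ℝ → ℝ,
      EulerData L T M U P →
      DataBounds L T C₀ u₀ u₁ v₀ →
      (∀ x ∈ Icc 0 L, ∀ t ∈ Icc 0 T, |v₀ x t| ≤ M) →
      RegSolution L T ε U P u₀ u₁ v₀ u →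
      ∀ x ∈ Ioo 0 L, ∀ y ∈ Ioo (0:ℝ) 1, ∀ t ∈ Ioo 0 T,
        C₁⁻¹ * (1 - y) ≤ u x y t ∧ u x y t ≤ C₁ * (1 - y) := by
  set K := 3 * M + 2 * M ^ 2 + 1 with hK
  set K' := 6 * (C₀⁻¹ + 1) ^ 2 + 5 * M + 3 * M ^ 2 + 1 with hK'
  set Λ := C₀ + M + M ^ 2 + 1 with hΛ
  have hKpos : 0 < K := by positivity
  have hKpos' : 0 < K' := by positivity
  have hΛpos : 0 < Λ := by positivity
  set m := C₀⁻¹ * exp (-(K' * T)) / 2 with hm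
  have hmpos : 0 < m := by positivity
  refine ⟨Λ * exp (K * T) + m⁻¹, by positivity, ?_⟩
  intro ε hε U P u₀ u₁ v₀ u hE hD hv hR x hx y hy t ht
  have hz : 0 < 1 - y := by linarith [hy.2]
  constructor
  · have hlow : C₀⁻¹ * ((1 - y) - (1 - y) ^ 3 / 2) * exp (-(K' * t)) ≤ u x y t := by
      have hlim : Filter.Tendsto (fun δ => lowerBarrier C₀⁻¹ K' δ x y t) (nhdsWithin 0 (Ioi 0))
          (nhds (lowerBarrier C₀⁻¹ K' 0 x y t)) := by
        refine (Continuous.tendsto ?_ 0).mono_left nhdsWithin_le_nhds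
        unfold lowerBarrier
        fun_prop
      have hle : lowerBarrier C₀⁻¹ K' 0 x y t ≤ u x y t := by
        refine le_of_tendsto hlim ?_
        have hpos : 0 < ε * exp (-(K' * T)) := mul_pos hε.1 (exp_pos _)
        filter_upwards [Ioo_mem_nhdsGT hpos] with δ hδ
        refine (lowerBarrier_lt hM hC₀ hε hE hD hR hK' hx hy ht hδ.1 ?_).le
        have h := mul_lt_mul_of_pos_right hδ.2 (exp_pos (K' * T))
        rwa [mul_assoc, ← exp_add, neg_add_cancel, exp_zero, mul_one] at h
      simpa [lowerBarrier] using hle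
    have hinv : (Λ * exp (K * T) + m⁻¹)⁻¹ ≤ m := by
      refine inv_le_of_inv_le₀ hmpos ?_
      have : 0 < Λ * exp (K * T) := by positivity
      linarith
    refine (mul_le_mul_of_nonneg_right hinv hz.le).trans (le_trans ?_ hlow)
    have hexp : exp (-(K' * T)) ≤ exp (-(K' * t)) :=
      exp_le_exp.2 (neg_le_neg (mul_le_mul_of_nonneg_left ht.2.le hKpos'.le))
    have hcube : (1 - y) / 2 ≤ (1 - y) - (1 - y) ^ 3 / 2 := by
      have : (1 - y) ^ 3 ≤ 1 - y := pow_le_of_le_one hz.le (by linarith [hy.1]) (by norm_num)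
      linarith
    calc m * (1 - y) = C₀⁻¹ * ((1 - y) / 2) * exp (-(K' * T)) := by rw [hm]; ring
      _ ≤ _ := mul_le_mul (mul_le_mul_of_nonneg_left hcube (by positivity)) hexp (exp_pos _).le
        (mul_nonneg (by positivity) (by linarith))
  · have hup : u x y t ≤ Λ * (1 - y) * exp (K * t) := by
      have hlim : Filter.Tendsto (fun δ => upperBarrier Λ K δ x y t) (nhdsWithin 0 (Ioi 0))
          (nhds (upperBarrier Λ K 0 x y t)) := by
        refine (Continuous.tendsto ?_ 0).mono_left nhdsWithin_le_nhds
        unfold upperBarrier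
        fun_prop
      have hle : u x y t ≤ upperBarrier Λ K 0 x y t := by
        refine ge_of_tendsto hlim ?_
        filter_upwards [self_mem_nhdsWithin] with δ hδ
        exact (lt_upperBarrier hM hC₀ hε.1 hE hD hv hR hx hy ht hδ).le
      simpa [upperBarrier] using hle
    have hexp : exp (K * t) ≤ exp (K * T) :=
      exp_le_exp.2 (mul_le_mul_of_nonneg_left ht.2.le hKpos.le)
    calc u x y t ≤ Λ * (1 - y) * exp (K * t) := hup
      _ ≤ Λ * (1 - y) * exp (K * T) := by gcongr
      _ = Λ * exp (K * T) * (1 - y) := by ring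
      _ ≤ _ := mul_le_mul_of_nonneg_right (by linarith [inv_pos.2 hmpos]) hz.le

end
end

section
/- Let C₀, M > 0 and α > −1. There exists a constant C₃ > 0, depending only on α, L, T, C₀, M (and not on ε), such that for every ε ∈ (0,1) and every classical solution u of the regularized problem (2.9) whose data satisfy the bounds of Lemma 2.2 (C₀⁻¹(1−y) ≤ u₀^ε, u₁^ε ≤ C₀(1−y), v₀^ε ≤ 0, |v₀^ε| ≤ M, C²-norms of U, P bounded by M, U ≥ M⁻¹) and which itself satisfies C₁⁻¹(1−y) ≤ u ≤ C₁(1−y) on Q_T for some C₁ ≤ M, one has ∫_{Q_T} (1−y)^α |∂_y u| dx dy dt ≤ C₃ and ∫_{Q_T} (1−y)^α |∂_y u|² dx dy dt ≤ C₃. -/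
open Real Set MeasureTheory

noncomputable section

/-- The parabolic cylinder `Q_T = (0,L) × (0,1) × (0,T)`. -/
def QT (L T : ℝ) : Set (ℝ × ℝ × ℝ) := (Ioo 0 L) ×ˢ ((Ioo (0:ℝ) 1) ×ˢ (Ioo 0 T))

lemma Smooth3.hasDerivAt_fst {u : ℝ → ℝ → ℝ → ℝ} (hu : Smooth3 u) (x y t : ℝ) :
    HasDerivAt (fun s => u s y t) (Dx u x y t) x := by
  have h : ContDiff ℝ (⊤ : ℕ∞) (fun s => u s y t) :=
    hu.comp (f := fun s : ℝ => (s, y, t)) (by fun_prop)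
  exact (h.differentiable (by simp) x).hasDerivAt

lemma Smooth3.hasDerivAt_snd {u : ℝ → ℝ → ℝ → ℝ} (hu : Smooth3 u) (x y t : ℝ) :
    HasDerivAt (fun s => u x s t) (Dy u x y t) y := by
  have h : ContDiff ℝ (⊤ : ℕ∞) (fun s => u x s t) :=
    hu.comp (f := fun s : ℝ => (x, s, t)) (by fun_prop)
  exact (h.differentiable (by simp) y).hasDerivAt

lemma Smooth3.hasDerivAt_thd {u : ℝ → ℝ → ℝ → ℝ} (hu : Smooth3 u) (x y t : ℝ) :
    HasDerivAt (fun s => u x y s) (Dt u x y t) t := by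
  have h : ContDiff ℝ (⊤ : ℕ∞) (fun s => u x y s) :=
    hu.comp (f := fun s : ℝ => (x, y, s)) (by fun_prop)
  exact (h.differentiable (by simp) t).hasDerivAt

lemma Smooth3.fderiv_apply {u : ℝ → ℝ → ℝ → ℝ} (hu : Smooth3 u) (v : ℝ × ℝ × ℝ) :
    ContDiff ℝ (⊤ : ℕ∞)
      (fun p => fderiv ℝ (fun p : ℝ × ℝ × ℝ => u p.1 p.2.1 p.2.2) p v) :=
  (ContDiff.fderiv_right (m := (⊤ : ℕ∞)) hu (by simp)).clm_apply contDiff_const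

lemma Smooth3.dx {u : ℝ → ℝ → ℝ → ℝ} (hu : Smooth3 u) : Smooth3 (Dx u) := by
  have h := hu.fderiv_apply (1, 0, 0)
  unfold Smooth3
  convert h using 2 with p
  refine (hu.hasDerivAt_fst _ _ _).unique ?_
  have h1 := (hu.differentiable (by simp) p).hasFDerivAt
  exact h1.comp_hasDerivAt (f := fun s : ℝ => (s, p.2.1, p.2.2)) p.1
    ((hasDerivAt_id _).prodMk ((hasDerivAt_const _ _).prodMk (hasDerivAt_const _ _)))

lemma Smooth3.dy {u : ℝ → ℝ → ℝ → ℝ} (hu : Smooth3 u) : Smooth3 (Dy u) := by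
  have h := hu.fderiv_apply (0, 1, 0)
  unfold Smooth3
  convert h using 2 with p
  refine (hu.hasDerivAt_snd _ _ _).unique ?_
  have h1 := (hu.differentiable (by simp) p).hasFDerivAt
  exact h1.comp_hasDerivAt (f := fun s : ℝ => (p.1, s, p.2.2)) p.2.1
    ((hasDerivAt_const _ _).prodMk ((hasDerivAt_id _).prodMk (hasDerivAt_const _ _)))

lemma Smooth3.dt {u : ℝ → ℝ → ℝ → ℝ} (hu : Smooth3 u) : Smooth3 (Dt u) := by
  have h := hu.fderiv_apply (0, 0, 1)
  unfold Smooth3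
  convert h using 2 with p
  refine (hu.hasDerivAt_thd _ _ _).unique ?_
  have h1 := (hu.differentiable (by simp) p).hasFDerivAt
  exact h1.comp_hasDerivAt (f := fun s : ℝ => (p.1, p.2.1, s)) p.2.2
    ((hasDerivAt_const _ _).prodMk ((hasDerivAt_const _ _).prodMk (hasDerivAt_id _)))

lemma Dyy_eq (u : ℝ → ℝ → ℝ → ℝ) : Dyy u = Dy (Dy u) := by
  funext x y t
  simp only [Dyy, Dy, iteratedDeriv_succ, iteratedDeriv_zero]

lemma Smooth2.hasDerivAt_fst {f : ℝ → ℝ → ℝ} (hf : Smooth2 f) (x t : ℝ) :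
    HasDerivAt (fun s => f s t) (pd1 f x t) x := by
  have h : ContDiff ℝ (⊤ : ℕ∞) (fun s => f s t) :=
    hf.comp (f := fun s : ℝ => (s, t)) (by fun_prop)
  exact (h.differentiable (by simp) x).hasDerivAt

lemma Smooth2.pd1 {f : ℝ → ℝ → ℝ} (hf : Smooth2 f) : Smooth2 (pd1 f) := by
  have h : ContDiff ℝ (⊤ : ℕ∞)
      (fun p => fderiv ℝ (fun p : ℝ × ℝ => f p.1 p.2) p (1, 0)) :=
    (ContDiff.fderiv_right (m := (⊤ : ℕ∞)) hf (by simp)).clm_apply contDiff_const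
  unfold Smooth2
  convert h using 2 with p
  refine (hf.hasDerivAt_fst _ _).unique ?_
  have h1 := (hf.differentiable (by simp) p).hasFDerivAt
  exact h1.comp_hasDerivAt (f := fun s : ℝ => (s, p.2)) p.1
    ((hasDerivAt_id _).prodMk (hasDerivAt_const _ _))

/-- Integrating a partial derivative over a product set bounds it by boundary increments. -/
lemma abs_setIntegral_prod_deriv_le {β : Type*} [TopologicalSpace β] [SecondCountableTopology β]
    [MeasureSpace β] [BorelSpace β] [SFinite (volume : Measure β)]
    [IsFiniteMeasureOnCompacts (volume : Measure β)] [T2Space β]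
    {a : ℝ} (ha : 0 ≤ a) {K : Set β} (hK : IsCompact K) {D : ℝ × β → ℝ} {F : ℝ → β → ℝ}
    {k : β → ℝ} (hD : ContinuousOn D (Icc 0 a ×ˢ K)) (hk : IntegrableOn k K)
    (hF : ∀ x ∈ Icc 0 a, ∀ z ∈ K, HasDerivAt (fun s => F s z) (D (x, z)) x)
    (hb : ∀ z ∈ K, |F a z - F 0 z| ≤ k z) :
    |∫ p in Icc 0 a ×ˢ K, D p| ≤ ∫ z in K, k z := by
  have hI : IntegrableOn D (Icc 0 a ×ˢ K) :=
    hD.integrableOn_compact (isCompact_Icc.prod hK)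
  have hswap : ∫ p in Icc 0 a ×ˢ K, D p = ∫ z in K, ∫ x in Icc 0 a, D (x, z) := by
    rw [Measure.volume_eq_prod, ← Measure.prod_restrict, integral_prod_symm]
    rwa [Measure.prod_restrict, ← Measure.volume_eq_prod]
  rw [hswap, ← Real.norm_eq_abs]
  refine norm_integral_le_of_norm_le hk ?_
  filter_upwards [ae_restrict_mem hK.measurableSet] with z hz
  have hc : ContinuousOn (fun x => D (x, z)) (Icc 0 a) :=
    hD.comp (by fun_prop) fun x hx => ⟨hx, hz⟩
  have : ∫ x in Icc 0 a, D (x, z) = F a z - F 0 z := by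
    rw [integral_Icc_eq_integral_Ioc, ← intervalIntegral.integral_of_le ha]
    refine intervalIntegral.integral_eq_sub_of_hasDerivAt (f := fun s => F s z) ?_ ?_
    · rw [uIcc_of_le ha]; exact fun x hx => hF x hx z hz
    · apply ContinuousOn.intervalIntegrable; rwa [uIcc_of_le ha]
  rw [this]; exact hb z hz

/-- The closed box `[0,a] × [0,r] × [0,c]`. -/
def closedBox (a r c : ℝ) : Set (ℝ × ℝ × ℝ) := Icc 0 a ×ˢ (Icc 0 r ×ˢ Icc 0 c)

lemma isCompact_closedBox (a r c : ℝ) : IsCompact (closedBox a r c) :=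
  isCompact_Icc.prod (isCompact_Icc.prod isCompact_Icc)

lemma volume_real_Icc_zero {a : ℝ} (ha : 0 ≤ a) : volume.real (Icc 0 a) = a := by
  simp [measureReal_def, ha]

lemma setIntegral_prod_snd_const {r c : ℝ} (hc : 0 ≤ c) (k : ℝ → ℝ) :
    ∫ z in Icc 0 r ×ˢ Icc 0 c, k z.1 = c * ∫ y in Icc 0 r, k y := by
  have := setIntegral_prod_mul (μ := volume) (ν := volume) k (fun _ : ℝ => (1 : ℝ))
    (Icc 0 r) (Icc 0 c)
  simp only [mul_one, ← Measure.volume_eq_prod] at this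
  rw [this]; simp [hc, mul_comm]

lemma setIntegral_closedBox_weight {a r c : ℝ} (ha : 0 ≤ a) (hc : 0 ≤ c) (k : ℝ → ℝ) :
    ∫ p in closedBox a r c, k p.2.1 = a * (c * ∫ y in Icc 0 r, k y) := by
  have := setIntegral_prod_mul (μ := volume) (ν := volume) (fun _ : ℝ => (1 : ℝ))
    (fun z : ℝ × ℝ => k z.1) (Icc 0 a) (Icc 0 r ×ˢ Icc 0 c)
  simp only [one_mul, ← Measure.volume_eq_prod] at this
  rw [closedBox, this, setIntegral_prod_snd_const hc]; simp [ha]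

lemma abs_setIntegral_closedBox_deriv_fst_le {a r c : ℝ} (ha : 0 ≤ a) (hc : 0 ≤ c)
    {D F : ℝ → ℝ → ℝ → ℝ} {k : ℝ → ℝ}
    (hD : ContinuousOn (fun p : ℝ × ℝ × ℝ => D p.1 p.2.1 p.2.2) (closedBox a r c))
    (hk : ContinuousOn k (Icc 0 r))
    (hF : ∀ x ∈ Icc 0 a, ∀ y ∈ Icc 0 r, ∀ t ∈ Icc 0 c,
      HasDerivAt (fun s => F s y t) (D x y t) x)
    (hb : ∀ y ∈ Icc 0 r, ∀ t ∈ Icc 0 c, |F a y t - F 0 y t| ≤ k y) :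
    |∫ p in closedBox a r c, D p.1 p.2.1 p.2.2| ≤ c * ∫ y in Icc 0 r, k y := by
  rw [← setIntegral_prod_snd_const hc k]
  refine abs_setIntegral_prod_deriv_le (F := fun x z => F x z.1 z.2) ha
    (isCompact_Icc.prod isCompact_Icc) hD ?_ (fun x hx z hz => hF x hx _ hz.1 _ hz.2)
    (fun z hz => hb _ hz.1 _ hz.2)
  exact ContinuousOn.integrableOn_compact (isCompact_Icc.prod isCompact_Icc)
    (hk.comp (by fun_prop) fun z hz => hz.1)

lemma abs_setIntegral_closedBox_le {a r c B : ℝ} (ha : 0 ≤ a) {D : ℝ → ℝ → ℝ → ℝ}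
    (hD : ContinuousOn (fun p : ℝ × ℝ × ℝ => D p.1 p.2.1 p.2.2) (closedBox a r c))
    (hb : ∀ x ∈ Icc 0 a, |∫ z in Icc 0 r ×ˢ Icc 0 c, D x z.1 z.2| ≤ B) :
    |∫ p in closedBox a r c, D p.1 p.2.1 p.2.2| ≤ a * B := by
  have hI := hD.integrableOn_compact (μ := volume) (isCompact_closedBox a r c)
  rw [closedBox, Measure.volume_eq_prod] at *
  rw [setIntegral_prod _ hI, ← Real.norm_eq_abs, mul_comm]
  have := norm_setIntegral_le_of_norm_le_const (μ := volume) (s := Icc 0 a)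
    (f := fun x => ∫ z in Icc 0 r ×ˢ Icc 0 c, D x z.1 z.2) (by simp) hb
  rwa [volume_real_Icc_zero ha] at this

lemma abs_setIntegral_closedBox_deriv_snd_le {a r c B : ℝ} (ha : 0 ≤ a) (hr : 0 ≤ r)
    (hc : 0 ≤ c) {D F : ℝ → ℝ → ℝ → ℝ}
    (hD : ContinuousOn (fun p : ℝ × ℝ × ℝ => D p.1 p.2.1 p.2.2) (closedBox a r c))
    (hF : ∀ x ∈ Icc 0 a, ∀ y ∈ Icc 0 r, ∀ t ∈ Icc 0 c,
      HasDerivAt (fun s => F x s t) (D x y t) y)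
    (hb : ∀ x ∈ Icc 0 a, ∀ t ∈ Icc 0 c, |F x r t - F x 0 t| ≤ B) :
    |∫ p in closedBox a r c, D p.1 p.2.1 p.2.2| ≤ a * (c * B) := by
  refine abs_setIntegral_closedBox_le ha hD fun x hx => ?_
  refine (abs_setIntegral_prod_deriv_le (F := fun y t => F x y t) (k := fun _ => B) hr
    isCompact_Icc ?_ (by simp) (fun y hy t ht => hF x hx y hy t ht)
    (fun t ht => hb x hx t ht)).trans_eq (by simp [hc])
  exact hD.comp (f := fun z : ℝ × ℝ => (x, z.1, z.2)) (by fun_prop) fun z hz => ⟨hx, hz⟩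

lemma abs_setIntegral_closedBox_deriv_thd_le {a r c : ℝ} (ha : 0 ≤ a)
    (hc : 0 ≤ c) {D F : ℝ → ℝ → ℝ → ℝ} {k : ℝ → ℝ}
    (hD : ContinuousOn (fun p : ℝ × ℝ × ℝ => D p.1 p.2.1 p.2.2) (closedBox a r c))
    (hk : ContinuousOn k (Icc 0 r))
    (hF : ∀ x ∈ Icc 0 a, ∀ y ∈ Icc 0 r, ∀ t ∈ Icc 0 c,
      HasDerivAt (fun s => F x y s) (D x y t) t)
    (hb : ∀ x ∈ Icc 0 a, ∀ y ∈ Icc 0 r, |F x y c - F x y 0| ≤ k y) :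
    |∫ p in closedBox a r c, D p.1 p.2.1 p.2.2| ≤ a * ∫ y in Icc 0 r, k y := by
  refine abs_setIntegral_closedBox_le ha hD fun x hx => ?_
  have hs : ∫ z in Icc 0 r ×ˢ Icc 0 c, D x z.1 z.2
      = ∫ z in Icc 0 c ×ˢ Icc 0 r, D x z.2 z.1 := by
    simp only [Measure.volume_eq_prod]
    exact (setIntegral_prod_swap (Icc 0 r) (Icc 0 c) (fun z : ℝ × ℝ => D x z.1 z.2)).symm
  rw [hs]
  refine abs_setIntegral_prod_deriv_le (F := fun t y => F x y t) hc
    isCompact_Icc ?_ (hk.integrableOn_compact isCompact_Icc)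
    (fun t ht y hy => hF x hx y hy t ht) (fun y hy => hb x hx y hy)
  exact hD.comp (f := fun z : ℝ × ℝ => (x, z.2, z.1)) (by fun_prop)
    fun z hz => ⟨hx, hz.2, hz.1⟩

lemma setIntegral_one_sub_rpow_le {γ r : ℝ} (hγ : -1 < γ) (hr0 : 0 ≤ r) (hr1 : r < 1) :
    ∫ y in Icc 0 r, (1 - y) ^ γ ≤ (γ + 1)⁻¹ := by
  rw [integral_Icc_eq_integral_Ioc, ← intervalIntegral.integral_of_le hr0,
    intervalIntegral.integral_comp_sub_left (fun y => y ^ γ) 1, integral_rpow (Or.inl hγ),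
    sub_zero, Real.one_rpow, ← one_div]
  have : 0 ≤ (1 - r) ^ (γ + 1) := Real.rpow_nonneg (by linarith) _
  have : 0 < γ + 1 := by linarith
  gcongr; linarith

/-- Monotone exhaustion of `QT` by closed boxes staying away from `y = 1`. -/
lemma lintegral_QT_le {L T C r₀ : ℝ} (hr₀ : r₀ < 1) {f : ℝ → ℝ → ℝ → ℝ}
    (hf : ∀ r < 1, ContinuousOn (fun p : ℝ × ℝ × ℝ => f p.1 p.2.1 p.2.2) (closedBox L r T))
    (hf0 : ∀ r < 1, ∀ p ∈ closedBox L r T, 0 ≤ f p.1 p.2.1 p.2.2)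
    (hb : ∀ r ∈ Ico r₀ 1, ∫ p in closedBox L r T, f p.1 p.2.1 p.2.2 ≤ C) :
    ∫⁻ p in QT L T, ENNReal.ofReal (f p.1 p.2.1 p.2.2) ≤ ENNReal.ofReal C := by
  set ρ : ℕ → ℝ := fun n => 1 - (1 - r₀) * (1 / ((n : ℝ) + 1)) with hρ
  have hd : 0 < 1 - r₀ := sub_pos.2 hr₀
  have hr (n : ℕ) : ρ n ∈ Ico r₀ 1 := by
    have h : (0 : ℝ) < (n : ℝ) + 1 := by positivity
    have h1 : 1 / ((n : ℝ) + 1) ≤ 1 := by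
      rw [div_le_one h]; linarith [Nat.cast_nonneg (α := ℝ) n]
    have h2 : 0 < 1 / ((n : ℝ) + 1) := by positivity
    constructor <;> simp only [hρ] <;> nlinarith
  have hsub : QT L T ⊆ ⋃ n : ℕ, closedBox L (ρ n) T := by
    rintro ⟨x, y, t⟩ ⟨hx, hy, ht⟩
    obtain ⟨n, hn⟩ := exists_nat_one_div_lt (div_pos (sub_pos.2 hy.2) hd)
    refine mem_iUnion.2 ⟨n, Ioo_subset_Icc_self hx, ⟨hy.1.le, ?_⟩, Ioo_subset_Icc_self ht⟩
    rw [lt_div_iff₀ hd] at hn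
    simp only [hρ]
    linarith
  have hmono : Monotone fun n : ℕ => closedBox L (ρ n) T := by
    intro m n hmn
    refine prod_mono le_rfl (prod_mono (Icc_subset_Icc_right ?_) le_rfl)
    have : (m : ℝ) ≤ n := by exact_mod_cast hmn
    simp only [hρ]
    gcongr
  refine (lintegral_mono_set hsub).trans ?_
  rw [setLIntegral_iUnion_of_directed _ hmono.directed_le]
  refine iSup_le fun n => ?_
  rw [← ofReal_integral_eq_lintegral_ofReal
    ((hf _ (hr n).2).integrableOn_compact (isCompact_closedBox _ _ _))]
  · exact ENNReal.ofReal_le_ofReal (hb _ (hr n))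
  · filter_upwards [ae_restrict_mem (isCompact_closedBox _ _ _).measurableSet] with p hp
    exact hf0 _ (hr n).2 p hp

lemma ae_closedBox_mem_QT {L T r : ℝ} (hr : r ≤ 1) :
    ∀ᵐ p ∂(volume.restrict (closedBox L r T)), p ∈ QT L T := by
  have h : (Ioo 0 L ×ˢ (Ioo 0 r ×ˢ Ioo 0 T) : Set (ℝ × ℝ × ℝ)) =ᵐ[volume] closedBox L r T :=
    Measure.set_prod_ae_eq Ioo_ae_eq_Icc (Measure.set_prod_ae_eq Ioo_ae_eq_Icc Ioo_ae_eq_Icc)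
  rw [← Measure.restrict_congr_set h]
  filter_upwards [ae_restrict_mem
    (measurableSet_Ioo.prod (measurableSet_Ioo.prod measurableSet_Ioo))] with p hp
  exact ⟨hp.1, ⟨hp.2.1.1, hp.2.1.2.trans_le hr⟩, hp.2.2⟩

/-- An antiderivative of `s ↦ s / (s + ε)²`. -/
def entropy (ε s : ℝ) : ℝ := Real.log (s + ε) + ε / (s + ε)

lemma HasDerivAt.entropy {ε : ℝ} {f : ℝ → ℝ} {f' x : ℝ} (hf : HasDerivAt f f' x)
    (h : 0 < f x + ε) :
    HasDerivAt (fun s => entropy ε (f s)) (f x / (f x + ε) ^ 2 * f') x := by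
  have h1 := hf.add_const ε
  refine ((h1.log h.ne').add ((hasDerivAt_const x ε).div h1 h.ne')).congr_deriv ?_
  have := h.ne'
  field_simp
  ring

lemma abs_entropy_le {ε s w M σ : ℝ} (hε : 0 < ε) (hε1 : ε < 1) (hM : 0 < M) (hw : 0 < w)
    (hw1 : w ≤ 1) (hσ : 0 < σ) (hl : M⁻¹ * w ≤ s) (hu : s ≤ M * w) :
    |entropy ε s| ≤ (M + 1 + σ⁻¹) * w ^ (-σ) := by
  have hs : 0 < s := lt_of_lt_of_le (by positivity) hl
  have h1 : 1 ≤ w ^ (-σ) := Real.one_le_rpow_of_pos_of_le_one_of_nonpos hw hw1 (by linarith)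
  have h2 : ε / (s + ε) ≤ 1 := by rw [div_le_one (by positivity)]; linarith
  have h3 : 0 ≤ ε / (s + ε) := by positivity
  have h4 : Real.log (s + ε) ≤ M := by
    have := Real.log_le_sub_one_of_pos (show 0 < s + ε by positivity)
    nlinarith
  have h5 : -(M + w ^ (-σ) / σ) ≤ Real.log (s + ε) := by
    have ha : Real.log (M⁻¹ * w) ≤ Real.log (s + ε) :=
      Real.log_le_log (by positivity) (by linarith)
    rw [Real.log_mul (by positivity) hw.ne', Real.log_inv] at ha
    have hb := Real.log_le_rpow_div (inv_pos.2 hw).le hσ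
    rw [Real.log_inv, Real.inv_rpow hw.le, ← Real.rpow_neg hw.le] at hb
    have hc := Real.log_le_self hM.le
    linarith
  have h6 : 0 < w ^ (-σ) / σ := by positivity
  have h7 : (M + 1 + σ⁻¹) * w ^ (-σ) = (M + 1) * w ^ (-σ) + w ^ (-σ) / σ := by ring
  have h8 : M + 1 ≤ (M + 1) * w ^ (-σ) := le_mul_of_one_le_right (by linarith) h1
  rw [h7, entropy, abs_le]
  constructor <;> linarith

lemma energy_pointwise {M ε w u p r ut ux a a' b c W W' G h α B Z k : ℝ}
    (hM : 0 < M) (hε : 0 < ε) (hw : 0 < w) (hW : 0 < W)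
    (hl : M⁻¹ * w ≤ u) (hu : u ≤ M * w) (hWW : W' * w = W)
    (hpde : ut - (u + ε) ^ 2 * r + a * ux + b * p + c * u = 0)
    (hb : |b| ≤ B * w) (hc : |c| ≤ Z) (ha' : |a'| ≤ M) (hG : |W * h| ≤ k * G) (hWG : W ≤ G) :
    W * p ^ 2 ≤ 2 * ((W * p ^ 2 + W * u * r - α * W' * u * p)
      - W * (u / (u + ε) ^ 2 * ut) - (a * W * (u / (u + ε) ^ 2 * ux) + a' * W * h))
      + (2 * (M * k) + 2 * Z + (M * B + |α| * M) ^ 2) * G := by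
  have hupos : 0 < u := lt_of_lt_of_le (by positivity) hl
  have hv : 0 < u + ε := by positivity
  have hG0 : 0 ≤ G := hW.le.trans hWG
  set g := u / (u + ε) ^ 2 with hg
  have hg0 : 0 < g := by positivity
  have hgv : g * (u + ε) ^ 2 = u := by rw [hg]; field_simp
  have hgu : g * u ≤ 1 := by
    rw [hg, div_mul_eq_mul_div, div_le_one (by positivity)]; nlinarith
  have hgw : g * w ≤ M := by
    have : w ≤ M * u := by
      rw [inv_mul_le_iff₀ hM] at hl; exact hl
    nlinarith
  have hr : W * u * r = W * g * (ut + a * ux + b * p + c * u) := by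
    have : (u + ε) ^ 2 * r = ut + a * ux + b * p + c * u := by linarith
    rw [← this]; nth_rewrite 1 [← hgv]; ring
  have hB : 0 ≤ B := nonneg_of_mul_nonneg_left ((abs_nonneg b).trans hb) hw
  have hZ : 0 ≤ Z := (abs_nonneg c).trans hc
  have e1 : |g * b| ≤ M * B := by
    rw [abs_mul, abs_of_pos hg0]
    calc g * |b| ≤ g * (B * w) := by gcongr
      _ = (g * w) * B := by ring
      _ ≤ M * B := by gcongr
  have e2 : |W * (g * u * c)| ≤ Z * G := by
    rw [abs_mul, abs_mul, abs_of_pos hW, abs_of_pos (mul_pos hg0 hupos)]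
    calc W * (g * u * |c|) ≤ G * (1 * Z) := by gcongr
      _ = Z * G := by ring
  have hW' : 0 < W' := pos_of_mul_pos_left (hWW ▸ hW) hw.le
  have e3 : |α * W' * u * p| ≤ |α| * M * (W * |p|) := by
    rw [abs_mul, abs_mul, abs_mul, abs_of_pos hW', abs_of_pos hupos]
    calc |α| * W' * u * |p| ≤ |α| * W' * (M * w) * |p| := by gcongr
      _ = |α| * M * (W * |p|) := by rw [← hWW]; ring
  have e4 : |a' * (W * h)| ≤ M * (k * G) := by
    rw [abs_mul]; gcongr
  have e5 : |W * p * (g * b)| ≤ M * B * (W * |p|) := by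
    rw [abs_mul, abs_mul, abs_of_pos hW, mul_comm]; gcongr
  set K := M * B + |α| * M
  have e6 : 2 * K * (W * |p|) ≤ W * p ^ 2 + K ^ 2 * G := by
    have : 0 ≤ W * (|p| - K) ^ 2 := by positivity
    have h2 : K ^ 2 * W ≤ K ^ 2 * G := by gcongr
    rw [← sq_abs p]; nlinarith
  have e7 : M * B * (W * |p|) + |α| * M * (W * |p|) = K * (W * |p|) := by ring
  have l2 := (abs_le.1 e2).1
  have l3 := (abs_le.1 e3).2
  have l4 := (abs_le.1 e4).2
  have l5 := (abs_le.1 e5).1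
  rw [hr]
  linarith

lemma linear_bounds_closure {L T M : ℝ} (hL : 0 < L) (hT : 0 < T) {u : ℝ → ℝ → ℝ → ℝ}
    (hu : Smooth3 u)
    (h : ∀ x ∈ Ioo 0 L, ∀ y ∈ Ioo (0:ℝ) 1, ∀ t ∈ Ioo 0 T,
      M⁻¹ * (1 - y) ≤ u x y t ∧ u x y t ≤ M * (1 - y)) :
    ∀ x ∈ Icc 0 L, ∀ y ∈ Icc (0:ℝ) 1, ∀ t ∈ Icc 0 T,
      M⁻¹ * (1 - y) ≤ u x y t ∧ u x y t ≤ M * (1 - y) := by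
  have hc := hu.continuous
  have hclosed : IsClosed {p : ℝ × ℝ × ℝ | M⁻¹ * (1 - p.2.1) ≤ u p.1 p.2.1 p.2.2 ∧
      u p.1 p.2.1 p.2.2 ≤ M * (1 - p.2.1)} :=
    (isClosed_le (by fun_prop) hc).inter (isClosed_le hc (by fun_prop))
  have hsub := closure_minimal (s := QT L T)
    (fun p hp => h _ hp.1 _ hp.2.1 _ hp.2.2) hclosed
  rw [QT, closure_prod_eq, closure_prod_eq, closure_Ioo hL.ne, closure_Ioo zero_ne_one,
    closure_Ioo hT.ne] at hsub
  exact fun x hx y hy t ht => hsub (show (x, y, t) ∈ _ from ⟨hx, hy, ht⟩)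

lemma EulerData.abs_div_le {L T M : ℝ} {U P : ℝ → ℝ → ℝ} (hE : EulerData L T M U P)
    (hM : 0 < M) {x t s : ℝ} (hx : x ∈ Icc 0 L) (ht : t ∈ Icc 0 T) (hs : |s| ≤ M) :
    |s / U x t| ≤ M * M := by
  obtain ⟨-, -, hpos, -, -, -, -, hlow⟩ := hE
  have hU := hpos x hx t ht
  rw [abs_div, abs_of_pos hU, div_eq_mul_inv]
  exact mul_le_mul hs (inv_le_of_inv_le₀ hM (hlow x hx t ht)) (inv_pos.2 hU).le hM.le

lemma EulerData.abs_bcoef_le {L T M : ℝ} {U P : ℝ → ℝ → ℝ} (hE : EulerData L T M U P)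
    (hM : 0 < M) {x y t : ℝ} (hx : x ∈ Icc 0 L) (hy : y ∈ Icc (0:ℝ) 1) (ht : t ∈ Icc 0 T) :
    |bcoef U x y t| ≤ (2 * M + M * M) * (1 - y) := by
  obtain ⟨-, h1, h2, -⟩ := hE.2.2.2.2.2.1 x hx t ht
  have hq : |pd2 U x t / U x t| ≤ M * M := hE.abs_div_le hM hx ht h2
  have hw : 0 ≤ 1 - y := sub_nonneg.2 hy.2
  have he : bcoef U x y t = (1 - y) * ((1 + y) * pd1 U x t + pd2 U x t / U x t) := by
    rw [bcoef]; ring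
  rw [he, abs_mul, abs_of_nonneg hw, mul_comm]
  gcongr
  refine (abs_add_le _ _).trans (add_le_add ?_ hq)
  rw [abs_mul, abs_of_nonneg (by linarith [hy.1])]
  have : 1 + y ≤ 2 := by linarith [hy.2]
  gcongr

lemma EulerData.abs_ccoef_le {L T M : ℝ} {U P : ℝ → ℝ → ℝ} (hE : EulerData L T M U P)
    (hM : 0 < M) {x y t : ℝ} (hx : x ∈ Icc 0 L) (hy : y ∈ Icc (0:ℝ) 1) (ht : t ∈ Icc 0 T) :
    |ccoef U P x y t| ≤ M + M * M := by
  obtain ⟨-, h1, -⟩ := hE.2.2.2.2.2.1 x hx t ht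
  obtain ⟨-, h2, -⟩ := hE.2.2.2.2.2.2.1 x hx t ht
  have hq : |pd1 P x t / U x t| ≤ M * M := hE.abs_div_le hM hx ht h2
  have hw : 0 ≤ 1 - y := sub_nonneg.2 hy.2
  rw [ccoef]
  refine (abs_sub _ _).trans (add_le_add ?_ hq)
  rw [abs_mul, abs_of_nonneg hw, ← one_mul M]
  have : 1 - y ≤ 1 := by linarith [hy.1]
  gcongr

/-- Bound of the boundary flux at `y = 0`. -/
lemma RegSolution.abs_mul_Dy_zero_le {L T M ε : ℝ} {U P u₀ u₁ v₀ : ℝ → ℝ → ℝ}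
    {u : ℝ → ℝ → ℝ → ℝ} (hE : EulerData L T M U P) (hM : 0 < M) (hε : 0 < ε)
    (hv : ∀ x ∈ Icc 0 L, ∀ t ∈ Icc 0 T, |v₀ x t| ≤ M)
    (hR : RegSolution L T ε U P u₀ u₁ v₀ u) {x t : ℝ} (hx : x ∈ Icc 0 L) (ht : t ∈ Icc 0 T)
    (h0 : 0 ≤ u x 0 t) (h1 : u x 0 t ≤ M) :
    |u x 0 t * Dy u x 0 t| ≤ M * M + M * M := by
  obtain ⟨-, -, -, -, -, hbd⟩ := hR
  obtain ⟨-, h2, -⟩ := hE.2.2.2.2.2.2.1 x hx t ht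
  have hq : |pd1 P x t / U x t| ≤ M * M := hE.abs_div_le hM hx ht h2
  have hs : 0 < u x 0 t + ε := by linarith
  have he : u x 0 t * Dy u x 0 t
      = u x 0 t * v₀ x t + u x 0 t / (u x 0 t + ε) * (pd1 P x t / U x t) := by
    have : Dy u x 0 t = v₀ x t + (pd1 P x t / U x t) / (u x 0 t + ε) := by
      field_simp
      linarith [hbd x hx t ht, mul_comm (u x 0 t + ε) (Dy u x 0 t)]
    rw [this]; ring
  have hg : u x 0 t / (u x 0 t + ε) ≤ 1 := by rw [div_le_one hs]; linarith
  rw [he]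
  refine (abs_add_le _ _).trans (add_le_add ?_ ?_)
  · rw [abs_mul, abs_of_nonneg h0]; gcongr; exact hv x hx t ht
  · rw [abs_mul, abs_of_nonneg (by positivity), ← one_mul (M * M)]; gcongr

lemma abs_rpow_mul_le {α σ w M : ℝ} (hw : 0 < w) {h : ℝ} (hh : |h| ≤ M * w ^ (-σ)) :
    |w ^ α * h| ≤ M * w ^ (α - σ) := by
  rw [abs_mul, abs_of_pos (Real.rpow_pos_of_pos hw _), sub_eq_add_neg, Real.rpow_add hw]
  have := mul_le_mul_of_nonneg_left hh (Real.rpow_pos_of_pos hw α).le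
  linarith

lemma exists_rpow_mul_le_one {N κ : ℝ} (hN : 0 ≤ N) (hκ : 0 < κ) :
    ∃ r₀ : ℝ, 0 ≤ r₀ ∧ r₀ < 1 ∧ ∀ r ∈ Ico r₀ 1, N * (1 - r) ^ κ ≤ 1 := by
  have h1 : 0 < N + 1 := by linarith
  refine ⟨1 - (N + 1) ^ (-κ⁻¹), ?_, ?_, fun r hr => ?_⟩
  · rw [sub_nonneg]
    exact Real.rpow_le_one_of_one_le_of_nonpos (by linarith) (by simpa using hκ.le)
  · linarith [Real.rpow_pos_of_pos h1 (-κ⁻¹)]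
  · have h2 : (1 - r) ^ κ ≤ ((N + 1) ^ (-κ⁻¹)) ^ κ :=
      Real.rpow_le_rpow (by linarith [hr.2]) (by linarith [hr.1]) hκ.le
    rw [← Real.rpow_mul h1.le, neg_mul, inv_mul_cancel₀ hκ.ne', Real.rpow_neg_one] at h2
    calc N * (1 - r) ^ κ ≤ N * (N + 1)⁻¹ := by gcongr
      _ ≤ 1 := by rw [← div_eq_mul_inv, div_le_one h1]; linarith

/-- The `ε`-independent bound of the weighted energy of `∂_y u`. -/
def energyConst (L T M α σ : ℝ) : ℝ :=
  2 * (L * (T * (1 + (M * M + M * M))) + L * (2 * (M + 1 + σ⁻¹) * σ⁻¹)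
    + T * (2 * (M + 1) * (M + 1 + σ⁻¹) * σ⁻¹))
  + (2 * (M * (M + 1 + σ⁻¹)) + 2 * (M + M * M) + (M * (2 * M + M * M) + |α| * M) ^ 2)
    * (L * (T * σ⁻¹))

lemma RegSolution.setIntegral_weighted_Dy_sq_le {L T M α σ ε r N : ℝ}
    {U P u₀ u₁ v₀ : ℝ → ℝ → ℝ} {u : ℝ → ℝ → ℝ → ℝ} (hL : 0 < L) (hT : 0 < T) (hM : 0 < M)
    (hσ : 0 < σ) (hασ : α - σ = σ - 1) (hε : 0 < ε) (hε1 : ε < 1)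
    (hE : EulerData L T M U P) (hv : ∀ x ∈ Icc 0 L, ∀ t ∈ Icc 0 T, |v₀ x t| ≤ M)
    (hR : RegSolution L T ε U P u₀ u₁ v₀ u)
    (hub : ∀ x ∈ Icc 0 L, ∀ y ∈ Icc (0:ℝ) 1, ∀ t ∈ Icc 0 T,
      M⁻¹ * (1 - y) ≤ u x y t ∧ u x y t ≤ M * (1 - y))
    (hr0 : 0 ≤ r) (hr1 : r < 1)
    (hN : ∀ x ∈ Icc 0 L, ∀ y ∈ Icc (0:ℝ) 1, ∀ t ∈ Icc 0 T, |Dy u x y t| ≤ N)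
    (hrN : M * N * (1 - r) ^ (α + 1) ≤ 1) :
    ∫ p in closedBox L r T, (1 - p.2.1) ^ α * |Dy u p.1 p.2.1 p.2.2| ^ 2
      ≤ energyConst L T M α σ := by
  have hu : Smooth3 u := hR.1
  have hU : Smooth2 U := hE.1
  have hUb := hE.2.2.2.2.2.1
  have hy1 : ∀ y ∈ Icc 0 r, y ∈ Icc (0:ℝ) 1 := fun y hy => ⟨hy.1, hy.2.trans hr1.le⟩
  have hw : ∀ y ∈ Icc 0 r, 0 < 1 - y := fun y hy => by linarith [hy.2]
  have hupos : ∀ x ∈ Icc 0 L, ∀ y ∈ Icc 0 r, ∀ t ∈ Icc 0 T, 0 < u x y t := fun x hx y hy t ht =>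
    lt_of_lt_of_le (mul_pos (inv_pos.2 hM) (hw y hy)) (hub x hx y (hy1 y hy) t ht).1
  have hvpos : ∀ x ∈ Icc 0 L, ∀ y ∈ Icc 0 r, ∀ t ∈ Icc 0 T, 0 < u x y t + ε :=
    fun x hx y hy t ht => by linarith [hupos x hx y hy t ht]
  set k := M + 1 + σ⁻¹ with hk
  have hk0 : 0 < k := by positivity
  have hH : ∀ x ∈ Icc 0 L, ∀ y ∈ Icc 0 r, ∀ t ∈ Icc 0 T,
      |(1 - y) ^ α * entropy ε (u x y t)| ≤ k * (1 - y) ^ (α - σ) := fun x hx y hy t ht =>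
    abs_rpow_mul_le (hw y hy) (abs_entropy_le hε hε1 hM (hw y hy) (by linarith [hy.1]) hσ
      (hub x hx y (hy1 y hy) t ht).1 (hub x hx y (hy1 y hy) t ht).2)
  have cu := hu.continuous.continuousOn (s := closedBox L r T)
  have cx := hu.dx.continuous.continuousOn (s := closedBox L r T)
  have cy := hu.dy.continuous.continuousOn (s := closedBox L r T)
  have cyy := hu.dy.dy.continuous.continuousOn (s := closedBox L r T)
  have ct := hu.dt.continuous.continuousOn (s := closedBox L r T)
  have cU : ContinuousOn (fun p : ℝ × ℝ × ℝ => U p.1 p.2.2) (closedBox L r T) :=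
    (hU.continuous.comp (f := fun p : ℝ × ℝ × ℝ => (p.1, p.2.2)) (by fun_prop)).continuousOn
  have cUx : ContinuousOn (fun p : ℝ × ℝ × ℝ => pd1 U p.1 p.2.2) (closedBox L r T) :=
    (hU.pd1.continuous.comp (f := fun p : ℝ × ℝ × ℝ => (p.1, p.2.2)) (by fun_prop)).continuousOn
  have cwy : ∀ e : ℝ, ContinuousOn (fun y : ℝ => (1 - y) ^ e) (Icc 0 r) := fun e =>
    ContinuousOn.rpow_const (by fun_prop) fun y hy => Or.inl (hw y hy).ne'
  have cw : ∀ e : ℝ, ContinuousOn (fun p : ℝ × ℝ × ℝ => (1 - p.2.1) ^ e) (closedBox L r T) :=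
    fun e => (cwy e).comp (by fun_prop) fun p hp => hp.2.1
  have cv : ContinuousOn (fun p : ℝ × ℝ × ℝ => u p.1 p.2.1 p.2.2 + ε) (closedBox L r T) :=
    cu.add continuousOn_const
  have hv0 : ∀ p ∈ closedBox L r T, u p.1 p.2.1 p.2.2 + ε ≠ 0 := fun p hp =>
    (hvpos _ hp.1 _ hp.2.1 _ hp.2.2).ne'
  have cg : ContinuousOn (fun p : ℝ × ℝ × ℝ =>
      u p.1 p.2.1 p.2.2 / (u p.1 p.2.1 p.2.2 + ε) ^ 2) (closedBox L r T) :=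
    cu.div (cv.pow 2) fun p hp => pow_ne_zero 2 (hv0 p hp)
  have ch : ContinuousOn (fun p : ℝ × ℝ × ℝ => entropy ε (u p.1 p.2.1 p.2.2))
      (closedBox L r T) := (cv.log hv0).add (continuousOn_const.div cv hv0)
  let D₁ : ℝ → ℝ → ℝ → ℝ := fun x y t => (1 - y) ^ α * Dy u x y t ^ 2
    + (1 - y) ^ α * u x y t * Dy (Dy u) x y t - α * (1 - y) ^ (α - 1) * u x y t * Dy u x y t
  let D₂ : ℝ → ℝ → ℝ → ℝ := fun x y t =>
    (1 - y) ^ α * (u x y t / (u x y t + ε) ^ 2 * Dt u x y t)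
  let D₃ : ℝ → ℝ → ℝ → ℝ := fun x y t =>
    (y * U x t + ε) * (1 - y) ^ α * (u x y t / (u x y t + ε) ^ 2 * Dx u x y t)
      + y * pd1 U x t * (1 - y) ^ α * entropy ε (u x y t)
  have cD₁ : ContinuousOn (fun p : ℝ × ℝ × ℝ => D₁ p.1 p.2.1 p.2.2) (closedBox L r T) :=
    (((cw α).mul (cy.pow 2)).add (((cw α).mul cu).mul cyy)).sub
      (((continuousOn_const.mul (cw (α - 1))).mul cu).mul cy)
  have cD₂ : ContinuousOn (fun p : ℝ × ℝ × ℝ => D₂ p.1 p.2.1 p.2.2) (closedBox L r T) :=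
    (cw α).mul (cg.mul ct)
  have cyv : ContinuousOn (fun p : ℝ × ℝ × ℝ => p.2.1) (closedBox L r T) := by fun_prop
  have cD₃ : ContinuousOn (fun p : ℝ × ℝ × ℝ => D₃ p.1 p.2.1 p.2.2) (closedBox L r T) :=
    ((((cyv.mul cU).add continuousOn_const).mul (cw α)).mul (cg.mul cx)).add
      (((cyv.mul cUx).mul (cw α)).mul ch)
  have hI : ∫ y in Icc 0 r, (1 - y) ^ (α - σ) ≤ σ⁻¹ := by
    have := setIntegral_one_sub_rpow_le (γ := α - σ) (by linarith) hr0 hr1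
    rwa [hασ, sub_add_cancel, ← hασ] at this
  have b₁ : |∫ p in closedBox L r T, D₁ p.1 p.2.1 p.2.2| ≤ L * (T * (1 + (M * M + M * M))) := by
    refine abs_setIntegral_closedBox_deriv_snd_le
      (F := fun x y t => (1 - y) ^ α * (u x y t * Dy u x y t)) hL.le hr0 hT.le cD₁ ?_ ?_
    · intro x hx y hy t ht
      have hd := ((hasDerivAt_id y).const_sub 1).rpow_const (p := α) (Or.inl (hw y hy).ne')
      refine (hd.mul ((hu.hasDerivAt_snd x y t).mul
        (hu.dy.hasDerivAt_snd x y t))).congr_deriv ?_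
      simp only [D₁, id, Pi.mul_apply]; ring
    · intro x hx t ht
      refine (abs_sub _ _).trans (add_le_add ?_ ?_)
      · have hr : r ∈ Icc 0 r := ⟨hr0, le_rfl⟩
        have h1 := hw r hr
        rw [abs_mul, abs_mul, abs_of_pos (hupos x hx r hr t ht),
          abs_of_pos (Real.rpow_pos_of_pos h1 α)]
        calc (1 - r) ^ α * (u x r t * |Dy u x r t|)
            ≤ (1 - r) ^ α * ((M * (1 - r)) * N) := by
              gcongr
              · exact (hub x hx r (hy1 r hr) t ht).2
              · exact hN x hx r (hy1 r hr) t ht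
          _ = M * N * (1 - r) ^ (α + 1) := by rw [Real.rpow_add_one h1.ne']; ring
          _ ≤ 1 := hrN
      · have h0 : (0:ℝ) ∈ Icc 0 r := ⟨le_rfl, hr0⟩
        simp only [sub_zero, Real.one_rpow, one_mul]
        refine hR.abs_mul_Dy_zero_le hE hM hε hv hx ht (hupos x hx 0 h0 t ht).le ?_
        simpa using (hub x hx 0 (hy1 0 h0) t ht).2
  have b₂ : |∫ p in closedBox L r T, D₂ p.1 p.2.1 p.2.2| ≤ L * (2 * k * σ⁻¹) := by
    refine (abs_setIntegral_closedBox_deriv_thd_le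
      (F := fun x y t => (1 - y) ^ α * entropy ε (u x y t))
      (k := fun y => 2 * k * (1 - y) ^ (α - σ)) hL.le hT.le cD₂
      (continuousOn_const.mul (cwy _)) ?_ ?_).trans ?_
    · intro x hx y hy t ht
      exact ((hu.hasDerivAt_thd x y t).entropy (hvpos x hx y hy t ht)).const_mul _
    · intro x hx y hy
      refine (abs_sub _ _).trans ?_
      linarith [hH x hx y hy T ⟨hT.le, le_rfl⟩, hH x hx y hy 0 ⟨le_rfl, hT.le⟩]
    · rw [integral_const_mul]; gcongr
  have b₃ : |∫ p in closedBox L r T, D₃ p.1 p.2.1 p.2.2|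
      ≤ T * (2 * (M + 1) * k * σ⁻¹) := by
    have hF : ∀ x ∈ Icc 0 L, ∀ y ∈ Icc 0 r, ∀ t ∈ Icc 0 T,
        |(y * U x t + ε) * ((1 - y) ^ α * entropy ε (u x y t))|
          ≤ (M + 1) * (k * (1 - y) ^ (α - σ)) := by
      intro x hx y hy t ht
      rw [abs_mul]
      refine mul_le_mul ?_ (hH x hx y hy t ht) (abs_nonneg _) (by positivity)
      refine (abs_add_le _ _).trans (add_le_add ?_ (by rw [abs_of_pos hε]; exact hε1.le))
      rw [abs_mul, abs_of_nonneg hy.1, ← one_mul M]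
      exact mul_le_mul (hy1 y hy).2 (hUb x hx t ht).1 (abs_nonneg _) zero_le_one
    refine (abs_setIntegral_closedBox_deriv_fst_le
      (F := fun x y t => (y * U x t + ε) * ((1 - y) ^ α * entropy ε (u x y t)))
      (k := fun y => 2 * (M + 1) * k * (1 - y) ^ (α - σ)) hL.le hT.le cD₃
      (continuousOn_const.mul (cwy _)) ?_ ?_).trans ?_
    · intro x hx y hy t ht
      have h1 := ((hU.hasDerivAt_fst x t).const_mul y).add_const ε
      have h2 := ((hu.hasDerivAt_fst x y t).entropy (hvpos x hx y hy t ht)).const_mul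
        ((1 - y) ^ α)
      refine (h1.mul h2).congr_deriv ?_
      simp only [D₃]; ring
    · intro y hy t ht
      refine (abs_sub _ _).trans ?_
      linarith [hF L ⟨hL.le, le_rfl⟩ y hy t ht, hF 0 ⟨le_rfl, hL.le⟩ y hy t ht]
    · rw [integral_const_mul]; gcongr
  set Q := 2 * (M * k) + 2 * (M + M * M) + (M * (2 * M + M * M) + |α| * M) ^ 2 with hQ
  have hQ0 : 0 ≤ Q := by positivity
  have hcomp := isCompact_closedBox L r T
  have i₁ := cD₁.integrableOn_compact (μ := volume) hcomp
  have i₂ := cD₂.integrableOn_compact (μ := volume) hcomp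
  have i₃ := cD₃.integrableOn_compact (μ := volume) hcomp
  have i₄ := (cw (α - σ)).integrableOn_compact (μ := volume) hcomp
  have i₁₂ : IntegrableOn (fun p : ℝ × ℝ × ℝ => D₁ p.1 p.2.1 p.2.2 - D₂ p.1 p.2.1 p.2.2)
      (closedBox L r T) := i₁.sub i₂
  have i₁₂₃ : IntegrableOn (fun p : ℝ × ℝ × ℝ => 2 * (D₁ p.1 p.2.1 p.2.2
      - D₂ p.1 p.2.1 p.2.2 - D₃ p.1 p.2.1 p.2.2)) (closedBox L r T) := (i₁₂.sub i₃).const_mul 2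
  calc ∫ p in closedBox L r T, (1 - p.2.1) ^ α * |Dy u p.1 p.2.1 p.2.2| ^ 2
      ≤ ∫ p in closedBox L r T, (2 * (D₁ p.1 p.2.1 p.2.2 - D₂ p.1 p.2.1 p.2.2
          - D₃ p.1 p.2.1 p.2.2) + Q * (1 - p.2.1) ^ (α - σ)) := by
        refine integral_mono_ae
          (((cw α).mul (cy.abs.pow 2)).integrableOn_compact (μ := volume) hcomp)
          (i₁₂₃.add (i₄.const_mul Q)) ?_
        filter_upwards [ae_restrict_mem hcomp.measurableSet, ae_closedBox_mem_QT hr1.le]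
          with p hp hpQ
        obtain ⟨x, y, t⟩ := p
        obtain ⟨hx, hy, ht⟩ := hp
        have hpde := hR.2.1 x hpQ.1 y hpQ.2.1 t hpQ.2.2
        rw [Dyy_eq] at hpde
        have hwy := hw y hy
        have hbd := hub x hx y (hy1 y hy) t ht
        have ha' : |y * pd1 U x t| ≤ M := by
          rw [abs_mul, abs_of_nonneg hy.1, ← one_mul M]
          exact mul_le_mul (hy1 y hy).2 (hUb x hx t ht).2.1 (abs_nonneg _) zero_le_one
        have hWG : (1 - y) ^ α ≤ (1 - y) ^ (α - σ) :=
          Real.rpow_le_rpow_of_exponent_ge hwy (by linarith [hy.1]) (by linarith)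
        simp only [sq_abs]
        exact energy_pointwise hM hε hwy (Real.rpow_pos_of_pos hwy α) hbd.1 hbd.2
          (by rw [← Real.rpow_add_one hwy.ne', sub_add_cancel]) hpde
          (hE.abs_bcoef_le hM hx (hy1 y hy) ht) (hE.abs_ccoef_le hM hx (hy1 y hy) ht) ha'
          (hH x hx y hy t ht) hWG
    _ = 2 * ((∫ p in closedBox L r T, D₁ p.1 p.2.1 p.2.2)
          - (∫ p in closedBox L r T, D₂ p.1 p.2.1 p.2.2)
          - ∫ p in closedBox L r T, D₃ p.1 p.2.1 p.2.2)
          + Q * (L * (T * ∫ y in Icc 0 r, (1 - y) ^ (α - σ))) := by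
        rw [integral_add i₁₂₃ (i₄.const_mul Q),
          integral_const_mul, integral_const_mul, integral_sub i₁₂ i₃,
          integral_sub i₁ i₂, setIntegral_closedBox_weight hL.le hT.le
            (fun y => (1 - y) ^ (α - σ))]
    _ ≤ energyConst L T M α σ := by
        have h4 : Q * (L * (T * ∫ y in Icc 0 r, (1 - y) ^ (α - σ)))
            ≤ Q * (L * (T * σ⁻¹)) := by gcongr
        rw [energyConst, ← hk, ← hQ]
        linarith [(abs_le.1 b₁).2, (abs_le.1 b₂).1, (abs_le.1 b₃).1]

lemma energyConst_pos {L T M α σ : ℝ} (hL : 0 < L) (hT : 0 < T) (hM : 0 < M) (hσ : 0 < σ) :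
    0 < energyConst L T M α σ := by
  unfold energyConst; positivity

/-- Lemma 2.4: uniform weighted `L¹` and `L²` estimates on `∂_y u` for the regularized
solutions, for any weight exponent `α > -1`. -/
theorem weighted_dy_estimates (L T C₀ M α : ℝ)
    (hL : 0 < L) (hT : 0 < T) (hC₀ : 0 < C₀) (hM : 0 < M) (hα : -1 < α) :
    ∃ C₃ > (0:ℝ), ∀ ε ∈ Ioo (0:ℝ) 1, ∀ U P : ℝ → ℝ → ℝ, ∀ u₀ u₁ v₀ : ℝ → ℝ → ℝ,
      ∀ u : ℝ → ℝ → ℝ → ℝ, ∀ C₁ : ℝ,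
      EulerData L T M U P →
      DataBounds L T C₀ u₀ u₁ v₀ →
      (∀ x ∈ Icc 0 L, ∀ t ∈ Icc 0 T, |v₀ x t| ≤ M) →
      RegSolution L T ε U P u₀ u₁ v₀ u →
      0 < C₁ → C₁ ≤ M →
      (∀ x ∈ Ioo 0 L, ∀ y ∈ Ioo (0:ℝ) 1, ∀ t ∈ Ioo 0 T,
        C₁⁻¹ * (1 - y) ≤ u x y t ∧ u x y t ≤ C₁ * (1 - y)) →
      (∫⁻ p in QT L T,
          ENNReal.ofReal ((1 - p.2.1) ^ α * |Dy u p.1 p.2.1 p.2.2|) ≤ ENNReal.ofReal C₃) ∧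
      (∫⁻ p in QT L T,
          ENNReal.ofReal ((1 - p.2.1) ^ α * |Dy u p.1 p.2.1 p.2.2| ^ 2) ≤ ENNReal.ofReal C₃) := by
  set σ := (α + 1) / 2 with hσd
  have hσ : 0 < σ := by rw [hσd]; linarith
  have hασ : α - σ = σ - 1 := by rw [hσd]; ring
  have hC := energyConst_pos (α := α) hL hT hM hσ
  set C := energyConst L T M α σ with hCd
  have hD : 0 < L * (T * σ⁻¹) := by positivity
  refine ⟨C + L * (T * σ⁻¹), by positivity, ?_⟩
  intro ε hε U P u₀ u₁ v₀ u C₁ hE _ hv hR hC₁ hC₁M hu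
  have hsm : Smooth3 u := hR.1
  have hub := linear_bounds_closure (M := M) hL hT hsm fun x hx y hy t ht => by
    have hw : 0 ≤ 1 - y := sub_nonneg.2 hy.2.le
    obtain ⟨h1, h2⟩ := hu x hx y hy t ht
    exact ⟨le_trans (by gcongr) h1, h2.trans (by gcongr)⟩
  obtain ⟨N, hN⟩ := (isCompact_closedBox L 1 T).exists_bound_of_continuousOn
    (hsm.dy.continuous.continuousOn)
  have hN' : ∀ x ∈ Icc 0 L, ∀ y ∈ Icc (0:ℝ) 1, ∀ t ∈ Icc 0 T, |Dy u x y t| ≤ N :=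
    fun x hx y hy t ht => hN (x, y, t) ⟨hx, hy, ht⟩
  have hN0 : 0 ≤ N := (abs_nonneg _).trans
    (hN' 0 ⟨le_rfl, hL.le⟩ 0 ⟨le_rfl, zero_le_one⟩ 0 ⟨le_rfl, hT.le⟩)
  obtain ⟨r₀, hr₀, hr₀1, hr₀N⟩ :=
    exists_rpow_mul_le_one (mul_nonneg hM.le hN0) (show 0 < α + 1 by linarith)
  have hw : ∀ r < 1, ∀ p ∈ closedBox L r T, 0 < 1 - p.2.1 := fun r hr p hp => by
    linarith [hp.2.1.2]
  have cw : ∀ e : ℝ, ∀ r < 1, ContinuousOn (fun p : ℝ × ℝ × ℝ => (1 - p.2.1) ^ e)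
      (closedBox L r T) := fun e r hr =>
    ContinuousOn.rpow_const (by fun_prop) fun p hp => Or.inl (hw r hr p hp).ne'
  have cy : Continuous fun p : ℝ × ℝ × ℝ => Dy u p.1 p.2.1 p.2.2 := hsm.dy.continuous
  have c1 : ∀ r < 1, ContinuousOn (fun p : ℝ × ℝ × ℝ =>
      (1 - p.2.1) ^ α * |Dy u p.1 p.2.1 p.2.2|) (closedBox L r T) := fun r hr =>
    (cw α r hr).mul cy.abs.continuousOn
  have c2 : ∀ r < 1, ContinuousOn (fun p : ℝ × ℝ × ℝ =>
      (1 - p.2.1) ^ α * |Dy u p.1 p.2.1 p.2.2| ^ 2) (closedBox L r T) := fun r hr =>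
    (cw α r hr).mul (cy.abs.pow 2).continuousOn
  have hmain : ∀ r ∈ Ico r₀ 1, ∫ p in closedBox L r T,
      (1 - p.2.1) ^ α * |Dy u p.1 p.2.1 p.2.2| ^ 2 ≤ C := fun r hr =>
    hR.setIntegral_weighted_Dy_sq_le hL hT hM hσ hασ hε.1 hε.2 hE hv hub
      (hr₀.trans hr.1) hr.2 hN' (hr₀N r hr)
  constructor
  · refine lintegral_QT_le (f := fun x y t => (1 - y) ^ α * |Dy u x y t|) hr₀1 c1
      (fun r hr p hp => mul_nonneg (Real.rpow_nonneg (hw r hr p hp).le _) (abs_nonneg _))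
      fun r hr => ?_
    have hcomp := isCompact_closedBox L r T
    have i1 := (c1 r hr.2).integrableOn_compact (μ := volume) hcomp
    have i2 := (c2 r hr.2).integrableOn_compact (μ := volume) hcomp
    have i3 := (cw (α - σ) r hr.2).integrableOn_compact (μ := volume) hcomp
    have hI : ∫ y in Icc 0 r, (1 - y) ^ (α - σ) ≤ σ⁻¹ := by
      have := setIntegral_one_sub_rpow_le (γ := α - σ) (by linarith) (hr₀.trans hr.1) hr.2
      rwa [hασ, sub_add_cancel, ← hασ] at this
    calc ∫ p in closedBox L r T, (1 - p.2.1) ^ α * |Dy u p.1 p.2.1 p.2.2|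
        ≤ ∫ p in closedBox L r T, ((1 - p.2.1) ^ α * |Dy u p.1 p.2.1 p.2.2| ^ 2
            + (1 - p.2.1) ^ (α - σ)) := by
          refine setIntegral_mono_on i1 (i2.add i3) hcomp.measurableSet fun p hp => ?_
          have h1 := hw r hr.2 p hp
          have h2 : (1 - p.2.1) ^ α ≤ (1 - p.2.1) ^ (α - σ) :=
            Real.rpow_le_rpow_of_exponent_ge h1 (by linarith [hp.2.1.1]) (by linarith)
          have h3 := Real.rpow_pos_of_pos h1 α
          have h4 : |Dy u p.1 p.2.1 p.2.2| ≤ |Dy u p.1 p.2.1 p.2.2| ^ 2 + 1 := by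
            nlinarith [sq_nonneg (|Dy u p.1 p.2.1 p.2.2| - 1)]
          nlinarith [mul_le_mul_of_nonneg_left h4 h3.le]
      _ ≤ C + L * (T * σ⁻¹) := by
          rw [integral_add i2 i3, setIntegral_closedBox_weight hL.le hT.le
            (fun y => (1 - y) ^ (α - σ))]
          refine add_le_add (hmain r hr) ?_
          gcongr
  · exact lintegral_QT_le (f := fun x y t => (1 - y) ^ α * |Dy u x y t| ^ 2) hr₀1 c2
      (fun r hr p hp => mul_nonneg (Real.rpow_nonneg (hw r hr p hp).le _) (sq_nonneg _))
      fun r hr => (hmain r hr).trans (by linarith)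

end
end
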